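/- arXiv:2509.20738 — 2 statements merged into one kernel-verified Lean document; each statement's English description precedes it below -/
import Mathlib

section
/- Let G be a countable discrete infinite amenable group, π : (X,G) → (Y,G) a factor map between G-systems, and 𝒰 a finite open cover of X. Then the maps μ ↦ Asc_μ^+(G,𝒰|Y) and μ ↦ Asc_μ^-(G,𝒰|Y), from the set M(X,G) of G-invariant Borel probability measures (with the weak* topology) to [0,∞), are upper semi-continuous. -/
open MeasureTheory Filter Set

noncomputable section

namespace AscLocal

/-- Limit of a real sequence (a junk value if the sequence does not converge). -/
def limSeq (f : ℕ → ℝ) : ℝ := limUnder Filter.atTop f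

variable {G X Y : Type*}

/-- `U` is a cover of the whole space. -/
def IsCover (U : Finset (Set X)) : Prop := ⋃₀ (U : Set (Set X)) = Set.univ

/-- every member of `α` is contained in some member of `U` (`α ⪰ U`). -/
def Refines (α U : Finset (Set X)) : Prop := ∀ A ∈ α, ∃ B ∈ U, A ⊆ B

/-- `α` is a finite measurable partition of the space. -/
def IsMPartition [MeasurableSpace X] (α : Finset (Set X)) : Prop :=
  IsCover α ∧ (∀ A ∈ α, MeasurableSet A) ∧
    ∀ A ∈ α, ∀ B ∈ α, A ≠ B → Disjoint A B

/-- Følner sequence of a group. -/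
def IsFolner [Group G] [DecidableEq G] (F : ℕ → Finset G) : Prop :=
  (∀ n, (F n).Nonempty) ∧
    ∀ g : G, Tendsto (fun n =>
      ((((((F n).image fun h => g * h) \ F n) ∪ (F n \ ((F n).image fun h => g * h)))).card : ℝ)
        / ((F n).card : ℝ)) atTop (nhds 0)

/-- The join `⋁_{g ∈ S} g⁻¹ U` of the pullbacks of the cover `U` under the action `act`. -/
def coverDyn [DecidableEq G] (act : G → X → X) (U : Finset (Set X)) (S : Finset G) :
    Finset (Set X) := by
  classical
  exact (S.pi fun _ => U).image fun f => ⋂ g, ⋂ (h : g ∈ S), act g ⁻¹' f g h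

/-- The join `⋁_{i ∈ S} T^{-i} U` for a single transformation `T`. -/
def coverIt (T : X → X) (U : Finset (Set X)) (S : Finset ℕ) : Finset (Set X) := by
  classical
  exact (S.pi fun _ => U).image fun f => ⋂ i, ⋂ (h : i ∈ S), (T^[i]) ⁻¹' f i h

/-- join of two finite families of sets. -/
def joinP (α β : Finset (Set X)) : Finset (Set X) := by
  classical
  exact (α ×ˢ β).image fun p => p.1 ∩ p.2

/-- minimal number of members of `U` needed to cover `K`. -/
def covNum (U : Finset (Set X)) (K : Set X) : ℕ :=
  sInf {n | ∃ V : Finset (Set X), V ⊆ U ∧ V.card = n ∧ K ⊆ ⋃₀ (V : Set (Set X))}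

/-- `N(U|Y) = sup_y N(U | pr⁻¹ y)` for a factor map `pr : X → Y`. -/
def covNumRel (pr : X → Y) (U : Finset (Set X)) : ℕ :=
  sSup {n | ∃ y : Y, n = covNum U (pr ⁻¹' {y})}

/-- Shannon entropy of a finite partition. -/
def entPart [MeasurableSpace X] (μ : Measure X) (α : Finset (Set X)) : ℝ :=
  ∑ A ∈ α, Real.negMulLog (μ A).toReal

/-- entropy of a finite cover: infimum over finer partitions. -/
def entCov [MeasurableSpace X] (μ : Measure X) (U : Finset (Set X)) : ℝ :=
  sInf {h | ∃ α, IsMPartition (X := X) α ∧ Refines α U ∧ h = entPart μ α}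

/-- conditional entropy of a partition given the σ-algebra `pr⁻¹ ℬ(Y)`:
`H_μ(α|Y) = ∑_{A ∈ α} ∫ -E(1_A|pr⁻¹ ℬ(Y)) log E(1_A|pr⁻¹ ℬ(Y)) dμ`. -/
def condEntPart [MeasurableSpace X] [MeasurableSpace Y] (μ : Measure X) (pr : X → Y)
    (α : Finset (Set X)) : ℝ :=
  ∑ A ∈ α, ∫ x, Real.negMulLog
    ((μ[A.indicator (fun _ => (1 : ℝ)) | MeasurableSpace.comap pr ‹_›]) x) ∂μ

/-- conditional entropy of a cover given `pr⁻¹ ℬ(Y)`: infimum over finer partitions. -/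
def condEntCover [MeasurableSpace X] [MeasurableSpace Y] (μ : Measure X) (pr : X → Y)
    (U : Finset (Set X)) : ℝ :=
  sInf {h | ∃ α, IsMPartition (X := X) α ∧ Refines α U ∧ h = condEntPart μ pr α}

/-- the coefficient `c^A_S = ∫ x^{|S|} (1-x)^{|A|-|S|} dλ(x)`. -/
def coeff (lam : Measure ℝ) (A S : Finset G) : ℝ :=
  ∫ x, x ^ S.card * (1 - x) ^ (A.card - S.card) ∂lam

/-- `lam` is a symmetric probability measure on `[0,1]`. -/
def IsCoeffMeasure (lam : Measure ℝ) : Prop :=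
  IsProbabilityMeasure lam ∧ lam (Set.Icc (0 : ℝ) 1)ᶜ = 0 ∧
    lam.map (fun x => 1 - x) = lam

/-- the uniform system of coefficients `c^A_S = 2^{-|A|}`. -/
def unifCoeff (A _S : Finset G) : ℝ := (1 / 2) ^ A.card

/-- the finite family `{U 0, …, U (d-1)}` as a `Finset` of sets. -/
def ofFun {d : ℕ} (U : Fin d → Set X) : Finset (Set X) := by
  classical
  exact Finset.univ.image U

section GroupAsc

variable [Group G] [DecidableEq G]

/-- the sequence `n ↦ (1/|F_n|) ∑_{S ⊆ F_n} c^{F_n}_S H_μ(α_S|Y)`. -/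
def ascCondPartSeq [MeasurableSpace X] [MeasurableSpace Y] (μ : Measure X) (pr : X → Y)
    (c : Finset G → Finset G → ℝ) (act : G → X → X) (α : Finset (Set X))
    (F : ℕ → Finset G) (n : ℕ) : ℝ :=
  (1 / ((F n).card : ℝ)) *
    ∑ S ∈ (F n).powerset, c (F n) S * condEntPart μ pr (coverDyn act α S)

/-- `Asc_μ(G,α|Y)`. -/
def AscCondPart [MeasurableSpace X] [MeasurableSpace Y] (μ : Measure X) (pr : X → Y)
    (c : Finset G → Finset G → ℝ) (act : G → X → X) (α : Finset (Set X))
    (F : ℕ → Finset G) : ℝ :=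
  limSeq (ascCondPartSeq μ pr c act α F)

/-- `Asc_μ^-(G,U|Y)`. -/
def AscCondMinus [MeasurableSpace X] [MeasurableSpace Y] (μ : Measure X) (pr : X → Y)
    (c : Finset G → Finset G → ℝ) (act : G → X → X) (U : Finset (Set X))
    (F : ℕ → Finset G) : ℝ :=
  limSeq fun n => (1 / ((F n).card : ℝ)) *
    ∑ S ∈ (F n).powerset, c (F n) S * condEntCover μ pr (coverDyn act U S)

/-- `Asc_μ^+(G,U|Y)`. -/
def AscCondPlus [MeasurableSpace X] [MeasurableSpace Y] (μ : Measure X) (pr : X → Y)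
    (c : Finset G → Finset G → ℝ) (act : G → X → X) (U : Finset (Set X))
    (F : ℕ → Finset G) : ℝ :=
  sInf {h | ∃ α, IsMPartition (X := X) α ∧ Refines α U ∧ h = AscCondPart μ pr c act α F}

/-- `Asc_μ(G,X|Y) = sup_α Asc_μ(G,α|Y)`. -/
def AscCondSup [MeasurableSpace X] [MeasurableSpace Y] (μ : Measure X) (pr : X → Y)
    (c : Finset G → Finset G → ℝ) (act : G → X → X) (F : ℕ → Finset G) : ℝ :=
  sSup {h | ∃ α, IsMPartition (X := X) α ∧ h = AscCondPart μ pr c act α F}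

/-- unconditional `Asc_μ(G,α)`. -/
def AscPart [MeasurableSpace X] (μ : Measure X)
    (c : Finset G → Finset G → ℝ) (act : G → X → X) (α : Finset (Set X))
    (F : ℕ → Finset G) : ℝ :=
  limSeq fun n => (1 / ((F n).card : ℝ)) *
    ∑ S ∈ (F n).powerset, c (F n) S * entPart μ (coverDyn act α S)

/-- unconditional `Asc_μ^-(G,U)`. -/
def AscMinus [MeasurableSpace X] (μ : Measure X)
    (c : Finset G → Finset G → ℝ) (act : G → X → X) (U : Finset (Set X))
    (F : ℕ → Finset G) : ℝ :=
  limSeq fun n => (1 / ((F n).card : ℝ)) *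
    ∑ S ∈ (F n).powerset, c (F n) S * entCov μ (coverDyn act U S)

/-- unconditional `Asc_μ^+(G,U)`. -/
def AscPlus [MeasurableSpace X] (μ : Measure X)
    (c : Finset G → Finset G → ℝ) (act : G → X → X) (U : Finset (Set X))
    (F : ℕ → Finset G) : ℝ :=
  sInf {h | ∃ α, IsMPartition (X := X) α ∧ Refines α U ∧ h = AscPart μ c act α F}

/-- conditional topological average sample complexity `Asc_top(G,U|Y)`. -/
def AscTopRel (c : Finset G → Finset G → ℝ) (act : G → X → X) (pr : X → Y)
    (U : Finset (Set X)) (F : ℕ → Finset G) : ℝ :=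
  limSeq fun n => (1 / ((F n).card : ℝ)) *
    ∑ S ∈ (F n).powerset, c (F n) S * Real.log (covNumRel pr (coverDyn act U S))

/-- topological average sample complexity `Asc_top(G,U)`. -/
def AscTop (c : Finset G → Finset G → ℝ) (act : G → X → X)
    (U : Finset (Set X)) (F : ℕ → Finset G) : ℝ :=
  limSeq fun n => (1 / ((F n).card : ℝ)) *
    ∑ S ∈ (F n).powerset, c (F n) S * Real.log (covNum (coverDyn act U S) Set.univ)

/-- `ν` is `G`-invariant and ergodic for the action `act`. -/
def IsErgodicAct [MeasurableSpace X] (act : G → X → X) (ν : Measure X) : Prop :=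
  (∀ g, Measure.map (act g) ν = ν) ∧
    ∀ A : Set X, MeasurableSet A → (∀ g, act g ⁻¹' A = A) → ν A = 0 ∨ ν A = 1

end GroupAsc

/-- `Asc_μ(T,α|Y)` for a `ℤ`-system, uniform coefficients `2^{-n}`. -/
def zAscCondPart [MeasurableSpace X] [MeasurableSpace Y] (μ : Measure X) (pr : X → Y)
    (T : X → X) (α : Finset (Set X)) : ℝ :=
  limSeq fun n => (1 / (n : ℝ)) * ∑ S ∈ (Finset.range n).powerset,
    ((1 : ℝ) / 2) ^ n * condEntPart μ pr (coverIt T α S)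

/-- `Asc_μ^-(T,U|Y)` for a `ℤ`-system, uniform coefficients. -/
def zAscCondMinus [MeasurableSpace X] [MeasurableSpace Y] (μ : Measure X) (pr : X → Y)
    (T : X → X) (U : Finset (Set X)) : ℝ :=
  limSeq fun n => (1 / (n : ℝ)) * ∑ S ∈ (Finset.range n).powerset,
    ((1 : ℝ) / 2) ^ n * condEntCover μ pr (coverIt T U S)

/-- `Asc_μ^+(T,U|Y)` for a `ℤ`-system, uniform coefficients. -/
def zAscCondPlus [MeasurableSpace X] [MeasurableSpace Y] (μ : Measure X) (pr : X → Y)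
    (T : X → X) (U : Finset (Set X)) : ℝ :=
  sInf {h | ∃ α, IsMPartition (X := X) α ∧ Refines α U ∧ h = zAscCondPart μ pr T α}

/-- `Asc_top(T,U|Y)` for a `ℤ`-system, uniform coefficients. -/
def zAscTop (T : X → X) (pr : X → Y) (U : Finset (Set X)) : ℝ :=
  limSeq fun n => (1 / (n : ℝ)) * ∑ S ∈ (Finset.range n).powerset,
    ((1 : ℝ) / 2) ^ n * Real.log (covNumRel pr (coverIt T U S))

end AscLocal


namespace AscLocal

/-- conditions used in the Ornstein–Weiss lemma -/
structure OWFun {G : Type*} [Group G] [DecidableEq G] (f : Finset G → ℝ) (M : ℝ) : Prop where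
  sub : ∀ A B, f (A ∪ B) ≤ f A + f B
  inv : ∀ A g, f (A.image fun h => h * g) ≤ f A
  nn : ∀ A, 0 ≤ f A
  emp : f ∅ ≤ 0
  bd : ∀ A : Finset G, f A ≤ M * A.card

section OW
variable {G : Type*} [Group G] [DecidableEq G]

lemma OWFun.biUnion {f : Finset G → ℝ} {M : ℝ} (hf : OWFun f M) (K C : Finset G) :
    f (C.biUnion fun c => K.image fun h => h * c) ≤ C.card * f K := by
  induction C using Finset.induction_on with
  | empty => simpa using hf.emp
  | insert a s ha ih =>
    rw [Finset.biUnion_insert, Finset.card_insert_of_notMem ha]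
    push_cast
    linarith [hf.sub (K.image fun h => h * a) (s.biUnion fun c => K.image fun h => h * c),
      hf.inv K a]

/-- inner boundary -/
def bdi (Q A : Finset G) : ℝ := ∑ k ∈ Q, ((A.filter fun c => k * c ∉ A).card : ℝ)

/-- outer boundary -/
def bdo (Q K : Finset G) : ℝ := ∑ k ∈ Q, ((K.filter fun c => k⁻¹ * c ∉ K).card : ℝ)

lemma filling (K Ω P : Finset G) (hK : K.Nonempty) (η : ℝ) (h1 : η < 1)
    (hP : ∀ c ∈ P, ∀ k ∈ K, k * c ∈ Ω) :
    ∃ C : Finset G, (C.biUnion fun c => K.image fun h => h * c) ⊆ Ω ∧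
      (1 - η) * (K.card * C.card) ≤ ((C.biUnion fun c => K.image fun h => h * c).card : ℝ) ∧
      η * P.card ≤ ((C.biUnion fun c => K.image fun h => h * c).card : ℝ) := by
  classical
  set D : Finset G → Finset G := fun C => C.biUnion fun c => K.image fun h => h * c with hD
  obtain ⟨C, hC, hmax⟩ := Finset.exists_max_image
    (P.powerset.filter fun C => (1 - η) * (K.card * C.card) ≤ ((D C).card : ℝ))
    (fun C => C.card) ⟨∅, by simp [hD]⟩
  simp only [Finset.mem_filter, Finset.mem_powerset] at hC hmax
  have hKpos : (0 : ℝ) < K.card := by exact_mod_cast hK.card_pos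
  have hcard : ∀ c, (K.image fun h => h * c).card = K.card := fun c =>
    Finset.card_image_of_injective _ (mul_left_injective c)
  refine ⟨C, ?_, hC.2, ?_⟩
  · intro x hx
    simp only [Finset.mem_biUnion, Finset.mem_image] at hx
    obtain ⟨c, hc, k, hk, rfl⟩ := hx
    exact hP c (hC.1 hc) k hk
  · have key : ∀ c ∈ P, η * K.card ≤ (((K.image fun h => h * c) ∩ D C).card : ℝ) := by
      intro c hc
      by_cases hcC : c ∈ C
      · have : (K.image fun h => h * c) ∩ D C = (K.image fun h => h * c) := by
          apply Finset.inter_eq_left.2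
          exact Finset.subset_biUnion_of_mem (fun c => K.image fun h => h * c) hcC
        rw [this, hcard]
        nlinarith
      · by_contra hcon
        push Not at hcon
        have h2 := hmax (insert c C) ⟨Finset.insert_subset hc hC.1, by
          rw [Finset.card_insert_of_notMem hcC]
          have e : D (insert c C) = (K.image fun h => h * c) ∪ D C := by
            simp [hD, Finset.biUnion_insert]
          rw [e]
          have h3 := Finset.card_union_add_card_inter (K.image fun h => h * c) (D C)
          rw [hcard] at h3
          have h4 : (((K.image fun h => h * c) ∪ D C).card : ℝ) +
            ((K.image fun h => h * c) ∩ D C).card = K.card + (D C).card := by exact_mod_cast h3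
          push_cast
          linarith [hC.2]⟩
        rw [Finset.card_insert_of_notMem hcC] at h2
        omega
    have h5 : η * K.card * P.card ≤ ∑ c ∈ P, (((K.image fun h => h * c) ∩ D C).card : ℝ) := by
      calc η * K.card * P.card = ∑ c ∈ P, η * (K.card : ℝ) := by simp; ring
        _ ≤ _ := Finset.sum_le_sum key
    have h6 : ∑ c ∈ P, ((K.image fun h => h * c) ∩ D C).card ≤ (D C).card * K.card := by
      have e1 : ∀ c ∈ P, ((K.image fun h => h * c) ∩ D C).card =
          ∑ d ∈ D C, if d * c⁻¹ ∈ K then 1 else 0 := by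
        intro c _
        rw [← Finset.card_filter]
        congr 1
        ext d
        simp only [Finset.mem_inter, Finset.mem_image, Finset.mem_filter]
        constructor
        · rintro ⟨⟨k, hk, rfl⟩, h⟩
          exact ⟨h, by simpa using hk⟩
        · rintro ⟨h, h'⟩
          exact ⟨⟨_, h', by simp⟩, h⟩
      rw [Finset.sum_congr rfl e1, Finset.sum_comm]
      rw [← smul_eq_mul]
      apply Finset.sum_le_card_nsmul
      intro d _
      rw [← Finset.card_filter]
      apply Finset.card_le_card_of_injOn (fun c => d * c⁻¹)
      · intro c hc
        simp only [Finset.coe_filter, Set.mem_ofPred_eq] at hc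
        exact hc.2
      · intro a _ b _ h
        simpa using h
    have h7 : ∑ c ∈ P, (((K.image fun h => h * c) ∩ D C).card : ℝ) ≤ (D C).card * K.card := by
      exact_mod_cast h6
    have h8 : η * P.card * K.card ≤ (D C).card * K.card := by linarith
    exact le_of_mul_le_mul_right h8 hKpos

lemma bdi_sdiff (Q A K C : Finset G) :
    bdi Q (A \ C.biUnion fun c => K.image fun h => h * c) ≤ bdi Q A + C.card * bdo Q K := by
  unfold bdi bdo
  rw [Finset.mul_sum, ← Finset.sum_add_distrib]
  apply Finset.sum_le_sum
  intro k _
  set D := C.biUnion fun c => K.image fun h => h * c with hD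
  have hsub : ((A \ D).filter fun c => k * c ∉ A \ D) ⊆ (A.filter fun c => k * c ∉ A) ∪
      C.biUnion (fun c => (K.filter fun x => k⁻¹ * x ∉ K).image fun x => k⁻¹ * x * c) := by
    intro x hx
    simp only [Finset.mem_filter, Finset.mem_sdiff, not_and, not_not, Finset.mem_union] at hx ⊢
    obtain ⟨⟨hxA, hxD⟩, hx2⟩ := hx
    by_cases h : k * x ∈ A
    · right
      have hh := hx2 h
      simp only [hD, Finset.mem_biUnion, Finset.mem_image] at hh
      obtain ⟨c, hc, y, hy, hyx⟩ := hh
      simp only [Finset.mem_biUnion, Finset.mem_image, Finset.mem_filter]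
      refine ⟨c, hc, y, ⟨hy, ?_⟩, ?_⟩
      · intro hcon
        apply hxD
        simp only [hD, Finset.mem_biUnion, Finset.mem_image]
        exact ⟨c, hc, _, hcon, by rw [mul_assoc, hyx]; simp⟩
      · rw [mul_assoc, hyx]; simp
    · left; exact ⟨hxA, h⟩
  have h1 := Finset.card_le_card hsub
  have h2 := Finset.card_union_le (A.filter fun c => k * c ∉ A)
    (C.biUnion (fun c => (K.filter fun x => k⁻¹ * x ∉ K).image fun x => k⁻¹ * x * c))
  have h3 : (C.biUnion (fun c => (K.filter fun x => k⁻¹ * x ∉ K).image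
      fun x => k⁻¹ * x * c)).card ≤ C.card * (K.filter fun x => k⁻¹ * x ∉ K).card :=
    Finset.card_biUnion_le_card_mul _ _ _ fun c _ => Finset.card_image_le
  exact_mod_cast (h1.trans h2).trans (Nat.add_le_add_left h3 _)

lemma folner_sum {F : ℕ → Finset G} (hF : IsFolner F) (Q : Finset G) :
    Tendsto (fun n => (∑ k ∈ Q, ((((((F n).image fun h => k * h) \ F n) ∪
      (F n \ ((F n).image fun h => k * h)))).card : ℝ)) / ((F n).card : ℝ)) atTop (nhds 0) := by
  simp_rw [Finset.sum_div]
  have := tendsto_finsetSum Q (fun k _ => hF.2 k)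
  simpa using this

lemma bdi_le {A : Finset G} (Q : Finset G) : bdi Q A ≤ ∑ k ∈ Q, (((((A.image fun h => k * h) \ A) ∪
      (A \ (A.image fun h => k * h)))).card : ℝ) := by
  apply Finset.sum_le_sum
  intro k _
  norm_cast
  apply Finset.card_le_card_of_injOn (fun c => k * c)
  · intro c hc
    simp at hc ⊢
    tauto
  · intro a _ b _ h
    simpa using h

lemma bdo_le {A : Finset G} (Q : Finset G) : bdo Q A ≤ ∑ k ∈ Q, (((((A.image fun h => k * h) \ A) ∪
      (A \ (A.image fun h => k * h)))).card : ℝ) := by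
  apply Finset.sum_le_sum
  intro k _
  norm_cast
  apply Finset.card_le_card
  intro c hc
  simp only [Finset.mem_filter, Finset.mem_union, Finset.mem_sdiff, Finset.mem_image] at hc ⊢
  right
  refine ⟨hc.1, ?_⟩
  rintro ⟨a, ha, rfl⟩
  apply hc.2
  simpa using ha

lemma folner_bdi {F : ℕ → Finset G} (hF : IsFolner F) (Q : Finset G) {κ : ℝ} (hκ : 0 < κ) :
    ∀ᶠ n in atTop, bdi Q (F n) ≤ κ * (F n).card := by
  filter_upwards [(folner_sum hF Q).eventually_lt_const hκ] with n hn
  have : (0 : ℝ) < (F n).card := by exact_mod_cast (hF.1 n).card_pos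
  rw [div_lt_iff₀ this] at hn
  exact (bdi_le Q).trans hn.le

lemma folner_bdo {F : ℕ → Finset G} (hF : IsFolner F) (Q : Finset G) {κ : ℝ} (hκ : 0 < κ) :
    ∀ᶠ n in atTop, bdo Q (F n) ≤ κ * (F n).card := by
  filter_upwards [(folner_sum hF Q).eventually_lt_const hκ] with n hn
  have : (0 : ℝ) < (F n).card := by exact_mod_cast (hF.1 n).card_pos
  rw [div_lt_iff₀ this] at hn
  exact (bdo_le Q).trans hn.le

lemma bdi_union_le_left (Q K A : Finset G) : bdi Q A ≤ bdi (Q ∪ K) A :=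
  Finset.sum_le_sum_of_subset_of_nonneg Finset.subset_union_left (by intros; positivity)

lemma bdi_union_le_right (Q K A : Finset G) : bdi K A ≤ bdi (Q ∪ K) A :=
  Finset.sum_le_sum_of_subset_of_nonneg Finset.subset_union_right (by intros; positivity)

lemma bdi_card (K A : Finset G) :
    (A.card : ℝ) - bdi K A ≤ (A.filter fun c => ∀ k ∈ K, k * c ∈ A).card := by
  have h : A ⊆ (A.filter fun c => ∀ k ∈ K, k * c ∈ A) ∪
      K.biUnion fun k => A.filter fun c => k * c ∉ A := by
    intro x hx
    simp only [Finset.mem_union, Finset.mem_filter, Finset.mem_biUnion]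
    by_cases h : ∀ k ∈ K, k * x ∈ A
    · exact Or.inl ⟨hx, h⟩
    · push Not at h
      obtain ⟨k, hk, h⟩ := h
      exact Or.inr ⟨k, hk, hx, h⟩
  have h1 := (Finset.card_le_card h).trans (Finset.card_union_le _ _)
  have h2 : (K.biUnion fun k => A.filter fun c => k * c ∉ A).card ≤
    ∑ k ∈ K, (A.filter fun c => k * c ∉ A).card := Finset.card_biUnion_le
  have h3 : A.card ≤ (A.filter fun c => ∀ k ∈ K, k * c ∈ A).card +
    ∑ k ∈ K, (A.filter fun c => k * c ∉ A).card := by omega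
  have h4 : (A.card : ℝ) ≤ (A.filter fun c => ∀ k ∈ K, k * c ∈ A).card +
    ∑ k ∈ K, ((A.filter fun c => k * c ∉ A).card : ℝ) := by exact_mod_cast h3
  unfold bdi
  linarith

lemma quasitile {T : ℕ → Finset G} (hT : IsFolner T) (η : ℝ) (h0 : 0 < η) (h1 : η ≤ 1 / 2)
    (m : ℕ) : ∃ (I : Finset ℕ) (Q : Finset G) (κ : ℝ), 0 < κ ∧
      ∀ (Ω : Finset G) (W : ℝ), (Ω.card : ℝ) ≤ W → bdi Q Ω ≤ κ * W →
        ∃ R ⊆ Ω, ((R.card : ℝ) ≤ η * W ∨ (R.card : ℝ) ≤ (1 - η / 2) ^ m * Ω.card) ∧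
          ∀ (f : Finset G → ℝ) (M L : ℝ), OWFun f M → (∀ i ∈ I, f (T i) ≤ L * (T i).card) →
            0 ≤ L → f Ω ≤ L / (1 - η) * (Ω.card - R.card) + f R := by
  induction m with
  | zero =>
    refine ⟨∅, ∅, 1, one_pos, fun Ω W _ _ => ⟨Ω, Finset.Subset.refl _, Or.inr (by simp), ?_⟩⟩
    intro f M L _ _ _
    simp
  | succ m ih =>
    obtain ⟨I, Q, κ, hκ, H⟩ := ih
    obtain ⟨n, hn⟩ := (folner_bdo hT Q (show 0 < κ / 8 by linarith)).exists
    set K := T n with hK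
    have hKne : K.Nonempty := hT.1 n
    have hKpos : (0 : ℝ) < K.card := by exact_mod_cast hKne.card_pos
    refine ⟨insert n I, Q ∪ K, min (κ / 2) (η / 2), by positivity, ?_⟩
    intro Ω W hΩ hb
    have hW : 0 ≤ W := le_trans (by positivity) hΩ
    by_cases hs : (Ω.card : ℝ) ≤ η * W
    · refine ⟨Ω, Finset.Subset.refl _, Or.inl hs, ?_⟩
      intro f M L _ _ _
      simp
    push Not at hs
    have hb1 : bdi Q Ω ≤ κ / 2 * W := (bdi_union_le_left Q K Ω).trans
      (hb.trans (mul_le_mul_of_nonneg_right (min_le_left _ _) hW))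
    have hb2 : bdi K Ω ≤ η / 2 * W := (bdi_union_le_right Q K Ω).trans
      (hb.trans (mul_le_mul_of_nonneg_right (min_le_right _ _) hW))
    have hP := bdi_card K Ω
    obtain ⟨C, hC1, hC2, hC3⟩ := filling K Ω (Ω.filter fun c => ∀ k ∈ K, k * c ∈ Ω) hKne η
      (by linarith) (by intro c hc; exact (Finset.mem_filter.1 hc).2)
    set D := C.biUnion fun c => K.image fun h => h * c with hD
    have hcardD : ((Ω \ D).card : ℝ) = Ω.card - D.card := by
      rw [Finset.card_sdiff_of_subset hC1, Nat.cast_sub (Finset.card_le_card hC1)]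
    have hDW : (D.card : ℝ) ≤ W := le_trans (by exact_mod_cast Finset.card_le_card hC1) hΩ
    have hDlow : η / 2 * Ω.card ≤ D.card := by
      refine le_trans ?_ hC3
      have : (Ω.card : ℝ) / 2 ≤ ((Ω.filter fun c => ∀ k ∈ K, k * c ∈ Ω).card : ℝ) := by linarith
      nlinarith
    have hCK : (K.card : ℝ) * C.card ≤ 2 * D.card := by
      have : (0 : ℝ) ≤ K.card * C.card := by positivity
      nlinarith
    have hb3 : bdi Q (Ω \ D) ≤ κ * W := by
      refine (bdi_sdiff Q Ω K C).trans ?_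
      have : (C.card : ℝ) * bdo Q K ≤ κ / 2 * W := by
        calc (C.card : ℝ) * bdo Q K ≤ C.card * (κ / 8 * K.card) := by gcongr
          _ = κ / 8 * (K.card * C.card) := by ring
          _ ≤ κ / 8 * (2 * W) := mul_le_mul_of_nonneg_left (by linarith) (by positivity)
          _ ≤ κ / 2 * W := by nlinarith
      linarith
    obtain ⟨R, hR1, hR2, hR3⟩ := H (Ω \ D) W (by rw [hcardD]; linarith [(by positivity : (0:ℝ) ≤ D.card)]) hb3
    refine ⟨R, hR1.trans Finset.sdiff_subset, ?_, ?_⟩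
    · rcases hR2 with h | h
      · exact Or.inl h
      · right
        refine h.trans ?_
        rw [pow_succ, mul_assoc]
        apply mul_le_mul_of_nonneg_left _ (pow_nonneg (by linarith) _)
        rw [hcardD]; linarith
    · intro f M L hf hL hL0
      have e1 := hR3 f M L hf (fun i hi => hL i (Finset.mem_insert_of_mem hi)) hL0
      have e2 : f Ω ≤ f D + f (Ω \ D) := by
        have := hf.sub D (Ω \ D)
        rwa [Finset.union_sdiff_of_subset hC1] at this
      have e3 : f D ≤ C.card * f K := hf.biUnion K C
      have e4 : f K ≤ L * K.card := hL n (Finset.mem_insert_self _ _)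
      have e5 : (C.card : ℝ) * f K ≤ L / (1 - η) * D.card := by
        have h1 : (0:ℝ) < 1 - η := by linarith
        rw [div_mul_eq_mul_div, le_div_iff₀ h1]
        calc (C.card : ℝ) * f K * (1 - η) ≤ C.card * (L * K.card) * (1 - η) := by gcongr
          _ = L * ((1 - η) * (K.card * C.card)) := by ring
          _ ≤ L * D.card := by gcongr
      rw [hcardD] at e1
      have : L / (1 - η) * (Ω.card - R.card) = L / (1 - η) * D.card + L / (1 - η) * (Ω.card - D.card - R.card) := by ring
      linarith

/-- Ornstein–Weiss, uniform version. -/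
lemma ow_uniform {F T : ℕ → Finset G} (hF : IsFolner F) (hT : IsFolner T) (ε : ℝ) (hε : 0 < ε) :
    ∃ I : Finset ℕ, ∀ᶠ n in atTop, ∀ (f : Finset G → ℝ) (M L : ℝ), OWFun f M →
      (∀ i ∈ I, f (T i) ≤ L * (T i).card) → 0 ≤ L → 0 ≤ M →
      f (F n) / (F n).card ≤ L + ε * M := by
  set η := min (1 / 2) (ε / 3) with hη
  have h0 : 0 < η := by positivity
  have h1 : η ≤ 1 / 2 := min_le_left _ _
  have h2 : η ≤ ε / 3 := min_le_right _ _
  obtain ⟨m, hm⟩ := exists_pow_lt_of_lt_one h0 (show 1 - η / 2 < 1 by linarith)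
  obtain ⟨I, Q, κ, hκ, H⟩ := quasitile hT η h0 h1 m
  refine ⟨I, ?_⟩
  filter_upwards [folner_bdi hF Q hκ] with n hn f M L hf hL hL0 hM
  have hpos : (0 : ℝ) < (F n).card := by exact_mod_cast (hF.1 n).card_pos
  rw [div_le_iff₀ hpos]
  rcases le_total M L with hML | hML
  · refine (hf.bd _).trans ?_
    gcongr
    nlinarith
  obtain ⟨R, hR1, hR2, hR3⟩ := H (F n) (F n).card le_rfl hn
  have hR : (R.card : ℝ) ≤ η * (F n).card := by
    rcases hR2 with h | h
    · exact h
    · exact h.trans (by gcongr)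
  have e := hR3 f M L hf hL hL0
  have e2 := hf.bd R
  have e3 : L / (1 - η) ≤ L + 2 * η * M := by
    rw [div_le_iff₀ (by linarith)]
    have : 0 ≤ η * M * (1 - 2 * η) := by
      apply mul_nonneg (by positivity); linarith
    nlinarith
  have e4 : L / (1 - η) * ((F n).card - R.card) ≤ (L + 2 * η * M) * (F n).card := by
    apply mul_le_mul e3 (by linarith [(by positivity : (0:ℝ) ≤ R.card)]) 
      (by have : (R.card:ℝ) ≤ (F n).card := by exact_mod_cast Finset.card_le_card hR1
          linarith) (by positivity)
  have e5 : M * R.card ≤ M * (η * (F n).card) := by gcongr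
  have e6 : 3 * η * M * (F n).card ≤ ε * M * (F n).card := by gcongr; linarith
  nlinarith

lemma folner_comp {F : ℕ → Finset G} (hF : IsFolner F) {φ : ℕ → ℕ} (hφ : StrictMono φ) :
    IsFolner (F ∘ φ) :=
  ⟨fun n => hF.1 _, fun g => (hF.2 g).comp hφ.tendsto_atTop⟩

lemma ow_lim {F : ℕ → Finset G} (hF : IsFolner F) {f : Finset G → ℝ} {M : ℝ} (hM : 0 ≤ M)
    (hf : OWFun f M) :
    ∃ l : ℝ, 0 ≤ l ∧ Tendsto (fun n => f (F n) / (F n).card) atTop (nhds l) := by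
  set a : ℕ → ℝ := fun n => f (F n) / (F n).card with ha
  have ha0 : ∀ n, 0 ≤ a n := fun n => div_nonneg (hf.nn _) (by positivity)
  have haM : ∀ n, a n ≤ M := fun n => by
    have hpos : (0 : ℝ) < (F n).card := by exact_mod_cast (hF.1 n).card_pos
    rw [ha]; simp only; rw [div_le_iff₀ hpos]; exact hf.bd _
  have hb1 : IsBoundedUnder (· ≤ ·) atTop a := isBoundedUnder_of ⟨M, haM⟩
  have hb2 : IsBoundedUnder (· ≥ ·) atTop a := isBoundedUnder_of ⟨0, ha0⟩
  have hl0 : 0 ≤ liminf a atTop :=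
    le_liminf_of_le hb1.isCoboundedUnder_ge (Eventually.of_forall ha0)
  refine ⟨liminf a atTop, hl0, ?_⟩
  apply tendsto_of_le_liminf_of_limsup_le le_rfl _ hb1 hb2
  apply le_of_forall_pos_le_add
  intro δ hδ
  set ε := δ / (1 + M) with hε
  have hεp : 0 < ε := by positivity
  have hfr : ∃ᶠ n in atTop, a n < liminf a atTop + ε := by
    apply frequently_lt_of_liminf_lt hb1.isCoboundedUnder_ge
    linarith
  obtain ⟨φ, hφ, hφ2⟩ := extraction_of_frequently_atTop hfr
  obtain ⟨I, hI⟩ := ow_uniform hF (folner_comp hF hφ) ε hεp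
  apply limsup_le_of_le hb2.isCoboundedUnder_le
  filter_upwards [hI] with n hn
  have := hn f M (liminf a atTop + ε) hf (by
    intro i _
    have hpos : (0 : ℝ) < (F (φ i)).card := by exact_mod_cast (hF.1 _).card_pos
    have := (hφ2 i).le
    rw [ha] at this; simp only at this; rwa [div_le_iff₀ hpos] at this) (by positivity) hM
  refine this.trans (le_of_eq ?_)
  rw [hε]; field_simp; ring

end OW
end AscLocal

namespace AscLocal

section CO
variable {G : Type*} [Group G] [DecidableEq G]

/-- averaged function -/
def avg (lam : Measure ℝ) (H : Finset G → ℝ) (A : Finset G) : ℝ :=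
  ∑ S ∈ A.powerset, coeff lam A S * H S

lemma lam_ae {lam : Measure ℝ} (hlam : IsCoeffMeasure lam) : ∀ᵐ x ∂lam, x ∈ Icc (0:ℝ) 1 :=
  hlam.2.1

lemma lam_int {lam : Measure ℝ} (hlam : IsCoeffMeasure lam) (s t : ℕ) :
    Integrable (fun x : ℝ => x ^ s * (1 - x) ^ t) lam := by
  have := hlam.1
  apply Integrable.of_bound (C := 1) (by fun_prop)
  filter_upwards [lam_ae hlam] with x hx
  rw [Real.norm_eq_abs, abs_of_nonneg (mul_nonneg (pow_nonneg hx.1 _) (pow_nonneg (by linarith [hx.2]) _))]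
  exact mul_le_one₀ (pow_le_one₀ hx.1 hx.2) (pow_nonneg (by linarith [hx.2]) _)
    (pow_le_one₀ (by linarith [hx.2]) (by linarith [hx.1]))

lemma coeff_nonneg {lam : Measure ℝ} (hlam : IsCoeffMeasure lam) (A S : Finset G) :
    0 ≤ coeff lam A S := by
  apply integral_nonneg_of_ae
  filter_upwards [lam_ae hlam] with x hx
  exact mul_nonneg (pow_nonneg hx.1 _) (pow_nonneg (by linarith [hx.2]) _)

lemma coeff_insert {lam : Measure ℝ} (hlam : IsCoeffMeasure lam) (A S : Finset G) (a : G)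
    (ha : a ∉ A) (hS : S ⊆ A) :
    coeff lam (insert a A) S + coeff lam (insert a A) (insert a S) = coeff lam A S := by
  unfold coeff
  rw [Finset.card_insert_of_notMem ha, Finset.card_insert_of_notMem (fun h => ha (hS h)),
    ← integral_add (lam_int hlam _ _) (lam_int hlam _ _)]
  congr 1
  ext x
  have h := Finset.card_le_card hS
  rw [Nat.add_sub_add_right, Nat.succ_sub h, pow_succ (1 - x)]
  ring

lemma avg_marginal {lam : Measure ℝ} (hlam : IsCoeffMeasure lam) (H : Finset G → ℝ)
    (B C : Finset G) (hd : Disjoint C B) :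
    ∑ S ∈ (C ∪ B).powerset, coeff lam (C ∪ B) S * H (S ∩ B) = avg lam H B := by
  induction C using Finset.induction_on with
  | empty =>
    simp only [Finset.empty_union, avg]
    apply Finset.sum_congr rfl
    intro S hS
    rw [Finset.inter_eq_left.2 (Finset.mem_powerset.1 hS)]
  | insert a C ha ih =>
    rw [Finset.disjoint_insert_left] at hd
    have haB : a ∉ C ∪ B := by simp [ha, hd.1]
    rw [Finset.insert_union, Finset.sum_powerset_insert haB, ← Finset.sum_add_distrib, ← ih hd.2]
    apply Finset.sum_congr rfl
    intro S hS
    rw [Finset.insert_inter_of_notMem hd.1, ← coeff_insert hlam _ S a haB (Finset.mem_powerset.1 hS)]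
    ring

lemma avg_marginal' {lam : Measure ℝ} (hlam : IsCoeffMeasure lam) (H : Finset G → ℝ)
    (A B : Finset G) (h : B ⊆ A) :
    ∑ S ∈ A.powerset, coeff lam A S * H (S ∩ B) = avg lam H B := by
  have := avg_marginal hlam H B (A \ B) Finset.sdiff_disjoint
  rwa [Finset.sdiff_union_of_subset h] at this

lemma coeff_sum {lam : Measure ℝ} (hlam : IsCoeffMeasure lam) (A : Finset G) :
    ∑ S ∈ A.powerset, coeff lam A S = 1 := by
  have := hlam.1
  have := avg_marginal' hlam (fun _ => 1) A ∅ (by simp)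
  simpa [avg, coeff] using this

lemma avg_le_add {lam : Measure ℝ} (hlam : IsCoeffMeasure lam) (H H' : Finset G → ℝ) (ε : ℝ)
    (A : Finset G) (h : ∀ S ⊆ A, H S ≤ H' S + ε) : avg lam H A ≤ avg lam H' A + ε := by
  have : avg lam H' A + ε = ∑ S ∈ A.powerset, coeff lam A S * (H' S + ε) := by
    simp_rw [mul_add, Finset.sum_add_distrib, ← Finset.sum_mul, coeff_sum hlam, avg, one_mul]
  rw [this]
  apply Finset.sum_le_sum
  intro S hS
  exact mul_le_mul_of_nonneg_left (h S (Finset.mem_powerset.1 hS)) (coeff_nonneg hlam _ _)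

lemma avg_ow {lam : Measure ℝ} (hlam : IsCoeffMeasure lam) {H : Finset G → ℝ} {M : ℝ}
    (hM : 0 ≤ M)
    (sub : ∀ A B, H (A ∪ B) ≤ H A + H B) (inv : ∀ A g, H (A.image fun h => h * g) ≤ H A)
    (nn : ∀ A, 0 ≤ H A) (emp : H ∅ ≤ 0) (bd : ∀ g, H {g} ≤ M) : OWFun (avg lam H) M := by
  have := hlam.1
  have nn' : ∀ A, 0 ≤ avg lam H A := fun A =>
    Finset.sum_nonneg fun S _ => mul_nonneg (coeff_nonneg hlam _ _) (nn S)
  have sub' : ∀ A B, avg lam H (A ∪ B) ≤ avg lam H A + avg lam H B := by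
    intro A B
    rw [← avg_marginal' hlam H (A ∪ B) A Finset.subset_union_left,
      ← avg_marginal' hlam H (A ∪ B) B Finset.subset_union_right, ← Finset.sum_add_distrib]
    apply Finset.sum_le_sum
    intro S hS
    rw [← mul_add]
    apply mul_le_mul_of_nonneg_left _ (coeff_nonneg hlam _ _)
    have := sub (S ∩ A) (S ∩ B)
    rwa [← Finset.inter_union_distrib_left, Finset.inter_eq_left.2 (Finset.mem_powerset.1 hS)] at this
  have emp' : avg lam H ∅ ≤ 0 := by
    simpa [avg, coeff] using emp
  refine ⟨sub', ?_, nn', emp', ?_⟩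
  · intro A g
    unfold avg
    rw [Finset.powerset_image, Finset.sum_image]
    · apply Finset.sum_le_sum
      intro S hS
      have e : coeff lam (A.image fun h => h * g) (S.image fun h => h * g) = coeff lam A S := by
        unfold coeff
        rw [Finset.card_image_of_injective _ (mul_left_injective g),
          Finset.card_image_of_injective _ (mul_left_injective g)]
      rw [e]
      exact mul_le_mul_of_nonneg_left (inv S g) (coeff_nonneg hlam _ _)
    · intro S _ S' _ h
      exact Finset.image_injective (mul_left_injective g) h
  · intro A
    induction A using Finset.induction_on with
    | empty => simpa using emp'
    | insert a s ha ih =>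
      rw [Finset.insert_eq, Finset.card_union_of_disjoint (by simpa using ha)]
      have h1 : avg lam H {a} ≤ M := by
        have h := avg_le_add hlam H (fun _ => 0) M {a} (by
          intro S hS
          rcases Finset.subset_singleton_iff.1 hS with rfl | rfl
          · linarith
          · simpa using bd a)
        simpa [avg] using h
      have := sub' {a} s
      push_cast
      simp only [Finset.card_singleton, Nat.cast_one]
      linarith

end CO
end AscLocal

namespace AscLocal

section EN
variable {X Y : Type*} [MeasurableSpace X] [MeasurableSpace Y]

/-- conditional probability of a set -/
def ce (μ : Measure X) (π : X → Y) (A : Set X) : X → ℝ :=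
  μ[A.indicator (fun _ => (1 : ℝ)) | MeasurableSpace.comap π ‹_›]

/-- contribution of a set to the conditional entropy -/
def hset (μ : Measure X) (π : X → Y) (A : Set X) : ℝ :=
  ∫ x, Real.negMulLog (ce μ π A x) ∂μ

lemma condEntPart_eq (μ : Measure X) (π : X → Y) (α : Finset (Set X)) :
    condEntPart μ π α = ∑ A ∈ α, hset μ π A := rfl

/-- the variational functional -/
def Psi (μ : Measure X) (π : X → Y) (φ : X → ℝ) (s : Y → ℝ) : ℝ :=
  ∫ x, (φ x * (-Real.log (s (π x)) - 1) + s (π x)) ∂μ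

lemma gibbs {p q : ℝ} (hp : 0 ≤ p) (hq : 0 < q) :
    Real.negMulLog p ≤ p * (-Real.log q - 1) + q := by
  rcases hp.eq_or_lt with rfl | hp
  · simp [hq.le]
  · have h := Real.log_le_sub_one_of_pos (div_pos hq hp)
    rw [Real.log_div hq.ne' hp.ne'] at h
    have h2 := mul_le_mul_of_nonneg_left h hp.le
    have h3 : p * (q / p - 1) = q - p := by field_simp
    rw [h3] at h2
    unfold Real.negMulLog
    linarith

lemma negMulLog_le_one {p : ℝ} (hp : 0 ≤ p) : Real.negMulLog p ≤ 1 := by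
  have := gibbs hp one_pos
  simp at this
  linarith

lemma int_ind {μ : Measure X} [IsProbabilityMeasure μ] {A : Set X} (hA : MeasurableSet A) :
    Integrable (A.indicator (fun _ => (1 : ℝ))) μ := (integrable_const 1).indicator hA

lemma ce_range {μ : Measure X} [IsProbabilityMeasure μ] {π : X → Y} (hπ : Measurable π)
    {A : Set X} (hA : MeasurableSet A) : ∀ᵐ x ∂μ, 0 ≤ ce μ π A x ∧ ce μ π A x ≤ 1 := by
  have h1 : 0 ≤ᵐ[μ] ce μ π A :=
    condExp_nonneg (Eventually.of_forall fun x => indicator_nonneg (by simp) x)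
  have h2 : ce μ π A ≤ᵐ[μ] μ[(fun _ => (1 : ℝ)) | MeasurableSpace.comap π ‹_›] :=
    condExp_mono (int_ind hA) (integrable_const 1)
      (Eventually.of_forall fun x => indicator_le_self' (by simp) x)
  rw [condExp_const hπ.comap_le] at h2
  filter_upwards [h1, h2] with x a b
  exact ⟨a, b⟩

lemma ce_meas (μ : Measure X) (π : X → Y) (A : Set X) :
    StronglyMeasurable[MeasurableSpace.comap π ‹_›] (ce μ π A) := stronglyMeasurable_condExp

lemma ce_meas' (μ : Measure X) {π : X → Y} (hπ : Measurable π) (A : Set X) :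
    Measurable (ce μ π A) := ((ce_meas μ π A).mono hπ.comap_le).measurable

lemma int_hset {μ : Measure X} [IsProbabilityMeasure μ] {π : X → Y} (hπ : Measurable π)
    {A : Set X} (hA : MeasurableSet A) : Integrable (fun x => Real.negMulLog (ce μ π A x)) μ := by
  apply Integrable.of_bound (C := 1)
  · exact (Real.continuous_negMulLog.measurable.comp (ce_meas' μ hπ A)).aestronglyMeasurable
  · filter_upwards [ce_range hπ hA] with x hx
    rw [Real.norm_eq_abs, abs_of_nonneg (Real.negMulLog_nonneg hx.1 hx.2)]
    exact negMulLog_le_one hx.1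

lemma hset_nonneg {μ : Measure X} [IsProbabilityMeasure μ] {π : X → Y} (hπ : Measurable π)
    {A : Set X} (hA : MeasurableSet A) : 0 ≤ hset μ π A := by
  apply integral_nonneg_of_ae
  filter_upwards [ce_range hπ hA] with x hx
  exact Real.negMulLog_nonneg hx.1 hx.2

lemma hset_le_one {μ : Measure X} [IsProbabilityMeasure μ] {π : X → Y} (hπ : Measurable π)
    {A : Set X} (hA : MeasurableSet A) : hset μ π A ≤ 1 := by
  have : hset μ π A ≤ ∫ x, (1:ℝ) ∂μ := by
    apply integral_mono_ae (int_hset hπ hA) (integrable_const 1)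
    filter_upwards [ce_range hπ hA] with x hx
    exact negMulLog_le_one hx.1
  simpa using this

lemma hset_empty (μ : Measure X) (π : X → Y) : hset μ π ∅ = 0 := by
  have : ce μ π ∅ = 0 := by
    unfold ce
    simp only [indicator_empty]
    exact condExp_zero
  simp [hset, this]

lemma hset_univ {μ : Measure X} [IsProbabilityMeasure μ] {π : X → Y} (hπ : Measurable π) :
    hset μ π univ = 0 := by
  have : ce μ π univ = fun _ => 1 := by
    unfold ce
    simp only [indicator_univ]
    exact condExp_const hπ.comap_le _
  simp [hset, this]

lemma int_ind_mul {μ : Measure X} [IsProbabilityMeasure μ] {π : X → Y} (hπ : Measurable π)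
    {A : Set X} (hA : MeasurableSet A) {w : Y → ℝ} (hw : Measurable w) {C : ℝ}
    (hC : ∀ y, |w y| ≤ C) :
    ∫ x, A.indicator (fun _ => (1:ℝ)) x * w (π x) ∂μ = ∫ x, ce μ π A x * w (π x) ∂μ := by
  have hwm : StronglyMeasurable[MeasurableSpace.comap π ‹_›] (w ∘ π) :=
    (hw.comp (comap_measurable π)).stronglyMeasurable
  have hint : Integrable (A.indicator (fun _ => (1:ℝ)) * (w ∘ π)) μ := by
    apply (int_ind hA).mul_bdd (c := C) (hw.comp hπ).aestronglyMeasurable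
    exact Eventually.of_forall fun x => hC _
  have h := condExp_mul_of_stronglyMeasurable_right hwm hint (int_ind hA)
  have h2 := integral_congr_ae h
  rw [integral_condExp hπ.comap_le] at h2
  exact h2

lemma log_bd {δ q : ℝ} (hδ : 0 < δ) (h1 : δ ≤ q) (h2 : q ≤ 1) :
    |(-Real.log q - 1)| ≤ -Real.log δ + 1 := by
  have h3 := Real.log_le_log hδ h1
  have h4 := Real.log_nonpos (hδ.le.trans h1) h2
  rw [abs_le]; constructor <;> linarith

lemma int_psi_aux {μ : Measure X} [IsProbabilityMeasure μ] {π : X → Y} (hπ : Measurable π)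
    {φ : X → ℝ} (hφ : Measurable φ) (hφ1 : ∀ᵐ x ∂μ, 0 ≤ φ x ∧ φ x ≤ 1) {s : Y → ℝ}
    (hs : Measurable s)
    {δ : ℝ} (hδ : 0 < δ) (h1 : ∀ y, δ ≤ s y ∧ s y ≤ 1) :
    Integrable (fun x => φ x * (-Real.log (s (π x)) - 1)) μ ∧
    Integrable (fun x => s (π x)) μ ∧
    Integrable (fun x => φ x * (-Real.log (s (π x)) - 1) + s (π x)) μ := by
  have a : Integrable (fun x => φ x * (-Real.log (s (π x)) - 1)) μ := by
    apply Integrable.of_bound (C := -Real.log δ + 1)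
    · apply Measurable.aestronglyMeasurable
      exact hφ.mul (((Real.measurable_log.comp (hs.comp hπ)).neg).sub_const 1)
    · filter_upwards [hφ1] with x hx
      rw [Real.norm_eq_abs, abs_mul, abs_of_nonneg hx.1]
      exact (mul_le_of_le_one_left (abs_nonneg _) hx.2).trans
        (log_bd hδ (h1 _).1 (h1 _).2)
  have b : Integrable (fun x => s (π x)) μ := by
    apply Integrable.of_bound (C := 1) (hs.comp hπ).aestronglyMeasurable
    refine Eventually.of_forall fun x => ?_
    rw [Real.norm_eq_abs, Function.comp_apply, abs_of_nonneg (hδ.le.trans (h1 _).1)]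
    exact (h1 _).2
  exact ⟨a, b, a.add b⟩

lemma ind_range (A : Set X) (x : X) :
    0 ≤ A.indicator (fun _ => (1:ℝ)) x ∧ A.indicator (fun _ => (1:ℝ)) x ≤ 1 := by
  by_cases h : x ∈ A <;> simp [h]

lemma psi_eq {μ : Measure X} [IsProbabilityMeasure μ] {π : X → Y} (hπ : Measurable π)
    {A : Set X} (hA : MeasurableSet A) {s : Y → ℝ} (hs : Measurable s)
    {δ : ℝ} (hδ : 0 < δ) (h1 : ∀ y, δ ≤ s y ∧ s y ≤ 1) :
    Psi μ π (A.indicator fun _ => 1) s = Psi μ π (ce μ π A) s := by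
  have i1 := int_psi_aux hπ (μ := μ) (measurable_const.indicator hA) (Eventually.of_forall (ind_range A)) hs hδ h1
  have i2 := int_psi_aux hπ (μ := μ) (ce_meas' μ hπ A) (ce_range hπ hA) hs hδ h1
  unfold Psi
  rw [integral_add i1.1 i1.2.1, integral_add i2.1 i2.2.1,
    int_ind_mul hπ hA (w := fun y => -Real.log (s y) - 1)
      (((Real.measurable_log.comp hs).neg).sub_const 1) (C := -Real.log δ + 1)
      (fun y => log_bd hδ (h1 y).1 (h1 y).2)]

lemma hset_le_psi {μ : Measure X} [IsProbabilityMeasure μ] {π : X → Y} (hπ : Measurable π)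
    {A : Set X} (hA : MeasurableSet A) {s : Y → ℝ} (hs : Measurable s)
    {δ : ℝ} (hδ : 0 < δ) (h1 : ∀ y, δ ≤ s y ∧ s y ≤ 1) :
    hset μ π A ≤ Psi μ π (A.indicator fun _ => 1) s := by
  rw [psi_eq hπ hA hs hδ h1]
  have i2 := int_psi_aux hπ (μ := μ) (ce_meas' μ hπ A) (ce_range hπ hA) hs hδ h1
  apply integral_mono_ae (int_hset hπ hA) i2.2.2
  filter_upwards [ce_range hπ hA] with x hx
  exact gibbs hx.1 (hδ.trans_le (h1 _).1)

lemma gibbs_rev {p q δ : ℝ} (hp : 0 ≤ p) (hp1 : p ≤ 1) (hδ : 0 < δ)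
    (hq : δ ≤ q) :
    p * (-Real.log q - 1) + q ≤ Real.negMulLog p + δ + (1 / δ + 1) * |max δ p - q| := by
  set t := max δ p with ht
  have ht0 : δ ≤ t := le_max_left _ _
  have htp : 0 < t := hδ.trans_le ht0
  have hqp : 0 < q := hδ.trans_le hq
  have e1 : p * (-Real.log t - 1) + t ≤ Real.negMulLog p + δ := by
    rcases le_total δ p with h | h
    · rw [ht, max_eq_right h, Real.negMulLog]; linarith
    · rw [ht, max_eq_left h, Real.negMulLog]
      rcases hp.eq_or_lt with rfl | hp
      · simp
      · have := Real.log_le_log hp h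
        nlinarith
  have e2 : Real.log t - Real.log q ≤ 1 / δ * |t - q| := by
    rw [← Real.log_div htp.ne' hqp.ne']
    refine (Real.log_le_sub_one_of_pos (div_pos htp hqp)).trans ?_
    have : t / q - 1 = (t - q) / q := by field_simp
    rw [this, div_eq_inv_mul]
    calc q⁻¹ * (t - q) ≤ q⁻¹ * |t - q| := by gcongr; exact le_abs_self _
      _ ≤ 1 / δ * |t - q| := by
        rw [one_div]; gcongr
  have e3 : p * (Real.log t - Real.log q) ≤ 1 / δ * |t - q| := by
    calc p * (Real.log t - Real.log q) ≤ p * (1 / δ * |t - q|) := by gcongr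
      _ ≤ _ := mul_le_of_le_one_left (by positivity) hp1
  have e4 : q - t ≤ |t - q| := by rw [abs_sub_comm]; exact le_abs_self _
  nlinarith

end EN

section EN2
variable {X Y : Type*} [MeasurableSpace X] [MetricSpace Y] [MeasurableSpace Y] [BorelSpace Y]

lemma hset_approx {μ : Measure X} [IsProbabilityMeasure μ] {π : X → Y} (hπ : Measurable π)
    {A : Set X} (hA : MeasurableSet A) {ε : ℝ} (hε : 0 < ε) :
    ∃ (δ : ℝ) (s : Y → ℝ), 0 < δ ∧ Continuous s ∧ (∀ y, δ ≤ s y ∧ s y ≤ 1) ∧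
      Psi μ π (A.indicator fun _ => 1) s ≤ hset μ π A + ε := by
  set δ := min 1 (ε / 2) with hδd
  have hδ : 0 < δ := by positivity
  have hδ1 : δ ≤ 1 := min_le_left _ _
  have hδ2 : δ ≤ ε / 2 := min_le_right _ _
  obtain ⟨e, he, hee⟩ := (ce_meas μ π A).exists_eq_measurable_comp
  have : IsProbabilityMeasure (μ.map π) := Measure.isProbabilityMeasure_map hπ.aemeasurable
  set t : Y → ℝ := fun y => min 1 (max δ (e y)) with ht
  have htm : Measurable t := measurable_const.min (measurable_const.max he.measurable)
  have hti : Integrable t (μ.map π) := by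
    apply Integrable.of_bound (C := 1) htm.aestronglyMeasurable
    refine Eventually.of_forall fun y => ?_
    rw [Real.norm_eq_abs, abs_of_nonneg (le_min zero_le_one (hδ.le.trans (le_max_left _ _)))]
    exact min_le_left _ _
  set ε' := ε / 2 / (1 / δ + 1) with hε'
  have hε'0 : 0 < ε' := by positivity
  obtain ⟨c, hc, hci⟩ := hti.exists_boundedContinuous_integral_sub_le hε'0
  set s : Y → ℝ := fun y => min 1 (max δ (c y)) with hs
  have hsc : Continuous s := continuous_const.min (continuous_const.max c.continuous)
  have hsr : ∀ y, δ ≤ s y ∧ s y ≤ 1 := fun y =>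
    ⟨le_min hδ1 (le_max_left _ _), min_le_left _ _⟩
  refine ⟨δ, s, hδ, hsc, hsr, ?_⟩
  rw [psi_eq hπ hA hsc.measurable hδ hsr]
  have i2 := int_psi_aux hπ (μ := μ) (ce_meas' μ hπ A) (ce_range hπ hA) hsc.measurable hδ hsr
  have hst : ∀ y, |t y - s y| ≤ ‖t y - c y‖ := by
    intro y
    have h1 : t y = min 1 (max δ (t y)) := by
      simp only [ht]
      rcases le_total (max δ (e y)) 1 with h | h
      · rw [min_eq_right h]; simp [h]
      · rw [min_eq_left h]; simp [hδ1]
    rw [h1, Real.norm_eq_abs]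
    simp only [hs]
    conv_rhs => rw [← h1]
    refine (abs_min_sub_min_le_max _ _ _ _).trans ?_
    simp only [sub_self, abs_zero]
    refine max_le (abs_nonneg _) ((abs_max_sub_max_le_max _ _ _ _).trans ?_)
    simp
  have hint : Integrable (fun y => ‖t y - c y‖) (μ.map π) := (hti.sub hci).norm
  have hint' : Integrable (fun x => ‖t (π x) - c (π x)‖) μ :=
    hint.comp_measurable hπ
  have hmap : ∫ x, ‖t (π x) - c (π x)‖ ∂μ ≤ ε' := by
    rw [integral_map hπ.aemeasurable hint.aestronglyMeasurable] at hc
    exact hc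
  calc Psi μ π (ce μ π A) s
      ≤ ∫ x, ((Real.negMulLog (ce μ π A x) + δ) + (1 / δ + 1) * ‖t (π x) - c (π x)‖) ∂μ := by
        apply integral_mono_ae i2.2.2 (((int_hset hπ hA).add (integrable_const δ)).add
          (hint'.const_mul _))
        filter_upwards [ce_range hπ hA] with x hx
        refine (gibbs_rev hx.1 hx.2 hδ (hsr (π x)).1).trans ?_
        have h2 : max δ (ce μ π A x) = t (π x) := by
          have : e (π x) = ce μ π A x := by rw [hee]; rfl
          simp only [ht]
          rw [this, min_eq_right (max_le hδ1 hx.2)]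
        rw [h2]
        have := hst (π x)
        simp only [Pi.add_apply]
        gcongr
    _ = hset μ π A + δ + (1 / δ + 1) * ∫ x, ‖t (π x) - c (π x)‖ ∂μ := by
        rw [integral_add (f := fun x => Real.negMulLog (ce μ π A x) + δ)
          ((int_hset hπ hA).add (integrable_const δ)) (hint'.const_mul _),
          integral_add (int_hset hπ hA) (integrable_const δ), integral_const_mul]
        simp [hset]
    _ ≤ hset μ π A + ε / 2 + (1 / δ + 1) * ε' := by gcongr
    _ = hset μ π A + ε := by rw [hε']; field_simp; ring

end EN2
end AscLocal

namespace AscLocal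

lemma negMulLog_sum_le {ι : Type*} (s : Finset ι) (p : ι → ℝ) (hp : ∀ i ∈ s, 0 ≤ p i) :
    Real.negMulLog (∑ i ∈ s, p i) ≤ ∑ i ∈ s, Real.negMulLog (p i) := by
  unfold Real.negMulLog
  rw [neg_mul, Finset.sum_mul, ← Finset.sum_neg_distrib]
  apply Finset.sum_le_sum
  intro i hi
  rcases (hp i hi).eq_or_lt with h | h
  · simp [← h]
  · have := Real.log_le_log h (Finset.single_le_sum hp hi)
    nlinarith

lemma negMulLog_join {ι κ : Type*} (s : Finset ι) (t : Finset κ) (p : ι → κ → ℝ)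
    (hp : ∀ i ∈ s, ∀ j ∈ t, 0 ≤ p i j) (h1 : ∑ i ∈ s, ∑ j ∈ t, p i j = 1) :
    ∑ i ∈ s, ∑ j ∈ t, Real.negMulLog (p i j) ≤
      ∑ i ∈ s, Real.negMulLog (∑ j ∈ t, p i j) + ∑ j ∈ t, Real.negMulLog (∑ i ∈ s, p i j) := by
  set a : ι → ℝ := fun i => ∑ j ∈ t, p i j with ha
  set b : κ → ℝ := fun j => ∑ i ∈ s, p i j with hb
  have hab : ∀ i ∈ s, ∀ j ∈ t, p i j ≤ a i ∧ p i j ≤ b j := fun i hi j hj =>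
    ⟨Finset.single_le_sum (f := fun j => p i j) (fun j hj => hp i hi j hj) hj,
     Finset.single_le_sum (f := fun i => p i j) (fun i hi => hp i hi j hj) hi⟩
  have key : ∀ i ∈ s, ∀ j ∈ t, Real.negMulLog (p i j) ≤
      (p i j * (-Real.log (a i)) + p i j * (-Real.log (b j))) + (a i * b j - p i j) := by
    intro i hi j hj
    have ⟨h2, h3⟩ := hab i hi j hj
    rcases (hp i hi j hj).eq_or_lt with h | h
    · rw [← h] at h2 h3 ⊢
      simp
      positivity
    · have ha0 := h.trans_le h2
      have hb0 := h.trans_le h3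
      have := gibbs h.le (mul_pos ha0 hb0)
      rw [Real.log_mul ha0.ne' hb0.ne'] at this
      linarith
  have hb1 : ∑ j ∈ t, b j = 1 := by rw [hb, Finset.sum_comm]; exact h1
  have e1 : ∑ i ∈ s, ∑ j ∈ t, p i j * (-Real.log (a i)) = ∑ i ∈ s, Real.negMulLog (a i) := by
    apply Finset.sum_congr rfl; intro i _
    rw [← Finset.sum_mul, Real.negMulLog]; simp [ha]
  have e2 : ∑ i ∈ s, ∑ j ∈ t, p i j * (-Real.log (b j)) = ∑ j ∈ t, Real.negMulLog (b j) := by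
    rw [Finset.sum_comm]
    apply Finset.sum_congr rfl; intro i _
    rw [← Finset.sum_mul, Real.negMulLog]; simp [hb]
  have e3 : ∑ i ∈ s, ∑ j ∈ t, a i * b j = 1 := by
    rw [← Finset.sum_mul_sum, hb1, mul_one]; exact h1
  calc _ ≤ ∑ i ∈ s, ∑ j ∈ t, ((p i j * (-Real.log (a i)) + p i j * (-Real.log (b j))) +
        (a i * b j - p i j)) := Finset.sum_le_sum fun i hi => Finset.sum_le_sum fun j hj => key i hi j hj
    _ = _ := by
      simp only [Finset.sum_add_distrib, Finset.sum_sub_distrib]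
      rw [e1, e2, e3, h1]; ring

section
variable {X Y : Type*} [MeasurableSpace X] [MeasurableSpace Y]

lemma ce_iUnion {μ : Measure X} [IsProbabilityMeasure μ] {π : X → Y}
    {ι : Type*} (t : Finset ι) (B : ι → Set X) (hB : ∀ i ∈ t, MeasurableSet (B i))
    (hd : (t : Set ι).PairwiseDisjoint B) :
    ce μ π (⋃ i ∈ t, B i) =ᵐ[μ] fun x => ∑ i ∈ t, ce μ π (B i) x := by
  have e : (⋃ i ∈ t, B i).indicator (fun _ => (1:ℝ)) =
      ∑ i ∈ t, (B i).indicator (fun _ => (1:ℝ)) := by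
    rw [Finset.indicator_biUnion t B hd]
    ext x; simp
  unfold ce
  rw [e]
  refine (condExp_finsetSum (fun i hi => int_ind (hB i hi)) _).trans ?_
  refine Eventually.of_forall fun x => ?_
  simp

lemma hset_iUnion_le {μ : Measure X} [IsProbabilityMeasure μ] {π : X → Y} (hπ : Measurable π)
    {ι : Type*} (t : Finset ι) (B : ι → Set X) (hB : ∀ i ∈ t, MeasurableSet (B i))
    (hd : (t : Set ι).PairwiseDisjoint B) :
    hset μ π (⋃ i ∈ t, B i) ≤ ∑ i ∈ t, hset μ π (B i) := by
  unfold hset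
  rw [← integral_finsetSum _ (fun i hi => int_hset hπ (hB i hi))]
  apply integral_mono_ae (int_hset hπ (Finset.measurableSet_biUnion _ hB))
    (integrable_finsetSum _ (fun i hi => int_hset hπ (hB i hi)))
  have h : ∀ᵐ x ∂μ, ∀ i ∈ t, 0 ≤ ce μ π (B i) x := by
    rw [Filter.eventually_all_finset]
    intro i hi
    filter_upwards [ce_range hπ (hB i hi)] with x hx using hx.1
  filter_upwards [h, ce_iUnion (μ := μ) (π := π) t B hB hd] with x hx hx2
  rw [hx2]
  exact negMulLog_sum_le t _ hx

lemma condEntPart_nonneg {μ : Measure X} [IsProbabilityMeasure μ] {π : X → Y} (hπ : Measurable π)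
    {α : Finset (Set X)} (hα : IsMPartition α) : 0 ≤ condEntPart μ π α :=
  Finset.sum_nonneg fun A hA => hset_nonneg hπ (hα.2.1 A hA)

lemma condEntPart_le_card {μ : Measure X} [IsProbabilityMeasure μ] {π : X → Y} (hπ : Measurable π)
    {α : Finset (Set X)} (hα : IsMPartition α) : condEntPart μ π α ≤ α.card := by
  rw [condEntPart_eq]
  calc _ ≤ ∑ A ∈ α, (1:ℝ) := Finset.sum_le_sum fun A hA => hset_le_one hπ (hα.2.1 A hA)
    _ = _ := by simp

lemma IsMPartition.cov {α : Finset (Set X)} (hα : IsMPartition α) (x : X) : ∃ A ∈ α, x ∈ A := by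
  have : x ∈ ⋃₀ (α : Set (Set X)) := by rw [hα.1]; trivial
  simpa using this

lemma isCover_iff {α : Finset (Set X)} : IsCover α ↔ ∀ x, ∃ A ∈ α, x ∈ A := by
  unfold IsCover
  rw [Set.eq_univ_iff_forall]
  simp

lemma condEntPart_mono {μ : Measure X} [IsProbabilityMeasure μ] {π : X → Y} (hπ : Measurable π)
    {α β : Finset (Set X)} (hα : IsMPartition α) (hβ : IsMPartition β) (h : Refines β α) :
    condEntPart μ π α ≤ condEntPart μ π β := by
  classical
  rw [condEntPart_eq, condEntPart_eq]
  have e1 : ∀ A ∈ α, hset μ π A ≤ ∑ B ∈ β, if B ⊆ A then hset μ π B else 0 := by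
    intro A hA
    rw [← Finset.sum_filter]
    have e : A = ⋃ B ∈ β.filter (fun B => B ⊆ A), B := by
      ext x
      simp only [Finset.mem_filter, mem_iUnion, exists_prop]
      constructor
      · intro hx
        obtain ⟨B, hB, hxB⟩ := hβ.cov x
        obtain ⟨A', hA', hBA⟩ := h B hB
        have : A = A' := by
          by_contra hne
          exact Set.disjoint_left.1 (hα.2.2 A hA A' hA' hne) hx (hBA hxB)
        exact ⟨B, ⟨hB, this ▸ hBA⟩, hxB⟩
      · rintro ⟨B, ⟨_, hBA⟩, hx⟩
        exact hBA hx
    conv_lhs => rw [e]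
    apply hset_iUnion_le hπ
    · intro B hB
      exact hβ.2.1 B (Finset.mem_filter.1 hB).1
    · intro B hB B' hB' hne
      simp only [Finset.coe_filter, Set.mem_ofPred_eq] at hB hB'
      exact hβ.2.2 B hB.1 B' hB'.1 hne
  refine (Finset.sum_le_sum e1).trans ?_
  rw [Finset.sum_comm]
  apply Finset.sum_le_sum
  intro B hB
  rcases B.eq_empty_or_nonempty with rfl | ⟨x, hx⟩
  · simp [hset_empty]
  · obtain ⟨A, hA, hBA⟩ := h B hB
    rw [Finset.sum_eq_single_of_mem A hA]
    · simp [hBA]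
    · intro A' hA' hne
      rw [if_neg]
      intro hBA'
      exact Set.disjoint_left.1 (hα.2.2 A' hA' A hA hne) (hBA' hx) (hBA hx)

lemma mem_joinP {α β : Finset (Set X)} {C : Set X} :
    C ∈ joinP α β ↔ ∃ A ∈ α, ∃ B ∈ β, A ∩ B = C := by
  simp [joinP]
  tauto

lemma joinP_part {α β : Finset (Set X)} (hα : IsMPartition α) (hβ : IsMPartition β) :
    IsMPartition (joinP α β) := by
  refine ⟨?_, ?_, ?_⟩
  · rw [isCover_iff]
    intro x
    obtain ⟨A, hA, hxA⟩ := hα.cov x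
    obtain ⟨B, hB, hxB⟩ := hβ.cov x
    exact ⟨A ∩ B, mem_joinP.2 ⟨A, hA, B, hB, rfl⟩, hxA, hxB⟩
  · intro C hC
    obtain ⟨A, hA, B, hB, rfl⟩ := mem_joinP.1 hC
    exact (hα.2.1 A hA).inter (hβ.2.1 B hB)
  · intro C hC C' hC' hne
    obtain ⟨A, hA, B, hB, rfl⟩ := mem_joinP.1 hC
    obtain ⟨A', hA', B', hB', rfl⟩ := mem_joinP.1 hC'
    rw [Set.disjoint_left]
    rintro x ⟨h1, h2⟩ ⟨h3, h4⟩
    apply hne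
    have : A = A' := by
      by_contra hn
      exact Set.disjoint_left.1 (hα.2.2 A hA A' hA' hn) h1 h3
    have : B = B' := by
      by_contra hn
      exact Set.disjoint_left.1 (hβ.2.2 B hB B' hB' hn) h2 h4
    simp [*]

lemma ce_split {μ : Measure X} [IsProbabilityMeasure μ] {π : X → Y}
    {β : Finset (Set X)} (hβ : IsMPartition β) {A : Set X} (hA : MeasurableSet A) :
    ∀ᵐ x ∂μ, ce μ π A x = ∑ B ∈ β, ce μ π (A ∩ B) x := by
  have e : A = ⋃ B ∈ β, A ∩ B := by
    ext x
    simp only [mem_iUnion, mem_inter_iff, exists_prop]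
    constructor
    · intro hx
      obtain ⟨B, hB, hxB⟩ := hβ.cov x
      exact ⟨B, hB, hx, hxB⟩
    · rintro ⟨B, _, hx, _⟩
      exact hx
  have := ce_iUnion (μ := μ) (π := π) β (fun B => A ∩ B) (fun B hB => hA.inter (hβ.2.1 B hB))
    (fun B hB B' hB' hne => (hβ.2.2 B hB B' hB' hne).mono inter_subset_right inter_subset_right)
  rwa [← e] at this

lemma condEntPart_join {μ : Measure X} [IsProbabilityMeasure μ] {π : X → Y} (hπ : Measurable π)
    {α β : Finset (Set X)} (hα : IsMPartition α) (hβ : IsMPartition β) :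
    condEntPart μ π (joinP α β) ≤ condEntPart μ π α + condEntPart μ π β := by
  classical
  have hm : ∀ A ∈ α, ∀ B ∈ β, MeasurableSet (A ∩ B) := fun A hA B hB =>
    (hα.2.1 A hA).inter (hβ.2.1 B hB)
  have h0 : condEntPart μ π (joinP α β) ≤ ∑ p ∈ α ×ˢ β, hset μ π (p.1 ∩ p.2) := by
    rw [condEntPart_eq]
    unfold joinP
    convert Finset.sum_image_le_of_nonneg (s := α ×ˢ β) (g := fun p => p.1 ∩ p.2)
      (f := fun A => hset μ π A) ?_
    intro p hp
    rw [Finset.mem_image] at hp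
    obtain ⟨q, hq, rfl⟩ := hp
    rw [Finset.mem_product] at hq
    exact hset_nonneg hπ (hm _ hq.1 _ hq.2)
  refine h0.trans ?_
  rw [Finset.sum_product, condEntPart_eq, condEntPart_eq]
  simp only [hset]
  have i1 : ∀ A ∈ α, Integrable (fun x => ∑ B ∈ β, Real.negMulLog (ce μ π (A ∩ B) x)) μ :=
    fun A hA => integrable_finsetSum _ fun B hB => int_hset hπ (hm A hA B hB)
  have i2 : Integrable (fun x => ∑ A ∈ α, Real.negMulLog (ce μ π A x)) μ :=
    integrable_finsetSum _ fun A hA => int_hset hπ (hα.2.1 A hA)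
  have i3 : Integrable (fun x => ∑ A ∈ β, Real.negMulLog (ce μ π A x)) μ :=
    integrable_finsetSum _ fun A hA => int_hset hπ (hβ.2.1 A hA)
  rw [← integral_finsetSum _ (fun A hA => int_hset hπ (hα.2.1 A hA)),
    ← integral_finsetSum _ (fun A hA => int_hset hπ (hβ.2.1 A hA)), ← integral_add i2 i3]
  have e : ∑ A ∈ α, ∑ B ∈ β, ∫ x, Real.negMulLog (ce μ π (A ∩ B) x) ∂μ =
      ∫ x, ∑ A ∈ α, ∑ B ∈ β, Real.negMulLog (ce μ π (A ∩ B) x) ∂μ := by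
    rw [integral_finsetSum _ i1]
    apply Finset.sum_congr rfl
    intro A hA
    rw [integral_finsetSum _ fun B hB => int_hset hπ (hm A hA B hB)]
  rw [e]
  apply integral_mono_ae (integrable_finsetSum _ i1) (i2.add i3)
  have a1 : ∀ᵐ x ∂μ, ∀ A ∈ α, ce μ π A x = ∑ B ∈ β, ce μ π (A ∩ B) x := by
    rw [Filter.eventually_all_finset]
    intro A hA
    exact ce_split hβ (hα.2.1 A hA)
  have a2 : ∀ᵐ x ∂μ, ∀ B ∈ β, ce μ π B x = ∑ A ∈ α, ce μ π (A ∩ B) x := by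
    rw [Filter.eventually_all_finset]
    intro B hB
    simp_rw [inter_comm _ B]
    exact ce_split hα (hβ.2.1 B hB)
  have a3 : ∀ᵐ x ∂μ, ∀ A ∈ α, ∀ B ∈ β, 0 ≤ ce μ π (A ∩ B) x := by
    rw [Filter.eventually_all_finset]
    intro A hA
    rw [Filter.eventually_all_finset]
    intro B hB
    filter_upwards [ce_range hπ (hm A hA B hB)] with x hx using hx.1
  have a4 := ce_split (μ := μ) (π := π) hα MeasurableSet.univ
  have a5 : ce μ π univ = fun _ => 1 := by
    unfold ce
    simp only [indicator_univ]
    exact condExp_const hπ.comap_le _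
  filter_upwards [a1, a2, a3, a4] with x h1 h2 h3 h4
  rw [a5] at h4
  simp only [univ_inter] at h4
  have := negMulLog_join α β (fun A B => ce μ π (A ∩ B) x) h3 (by
    rw [h4]; exact Finset.sum_congr rfl fun A hA => (h1 A hA).symm)
  refine this.trans (le_of_eq ?_)
  simp only [Pi.add_apply]
  congr 1
  · exact Finset.sum_congr rfl fun A hA => by rw [h1 A hA]
  · exact Finset.sum_congr rfl fun A hA => by rw [h2 A hA]

/-- signature partition -/
lemma exists_part {V : Finset (Set X)} (hV : IsCover V) (hVm : ∀ A ∈ V, MeasurableSet A) :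
    ∃ α, IsMPartition α ∧ Refines α V := by
  classical
  let sg : Finset (Set X) → Set X := fun W => ⋂ B ∈ V, {x | x ∈ B ↔ B ∈ W}
  have hsg : ∀ W x, x ∈ sg W ↔ ∀ B ∈ V, (x ∈ B ↔ B ∈ W) := by
    intro W x; simp [sg]
  refine ⟨(V.powerset.filter fun W => W.Nonempty).image sg, ⟨?_, ?_, ?_⟩, ?_⟩
  · rw [isCover_iff]
    intro x
    obtain ⟨A, hA, hx⟩ := isCover_iff.1 hV x
    refine ⟨sg (V.filter fun B => x ∈ B), Finset.mem_image_of_mem _ ?_, ?_⟩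
    · simp only [Finset.mem_filter, Finset.mem_powerset, Finset.filter_subset, true_and]
      exact ⟨A, by simp [hA, hx]⟩
    · rw [hsg]; intro B hB; simp [hB]
  · intro A hA
    obtain ⟨W, _, rfl⟩ := Finset.mem_image.1 hA
    apply Finset.measurableSet_biInter
    intro B hB
    by_cases h : B ∈ W
    · simpa [h] using hVm B hB
    · have e : {x | x ∈ B ↔ B ∈ W} = Bᶜ := by ext x; simp [h]
      rw [e]
      exact (hVm B hB).compl
  · intro A hA A' hA' hne
    obtain ⟨W, hW, rfl⟩ := Finset.mem_image.1 hA
    obtain ⟨W', hW', rfl⟩ := Finset.mem_image.1 hA'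
    rw [Set.disjoint_left]
    intro x hx hx'
    rw [hsg] at hx hx'
    apply hne
    congr 1
    simp only [Finset.mem_filter, Finset.mem_powerset] at hW hW'
    ext B
    constructor
    · intro hB; exact (hx' B (hW.1 hB)).1 ((hx B (hW.1 hB)).2 hB)
    · intro hB; exact (hx B (hW'.1 hB)).1 ((hx' B (hW'.1 hB)).2 hB)
  · intro A hA
    obtain ⟨W, hW, rfl⟩ := Finset.mem_image.1 hA
    simp only [Finset.mem_filter, Finset.mem_powerset] at hW
    obtain ⟨B, hB⟩ := hW.2
    exact ⟨B, hW.1 hB, fun x hx => ((hsg W x).1 hx B (hW.1 hB)).2 hB⟩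

lemma condEntCover_le {μ : Measure X} [IsProbabilityMeasure μ] {π : X → Y} (hπ : Measurable π)
    {α V : Finset (Set X)} (hα : IsMPartition α) (h : Refines α V) :
    condEntCover μ π V ≤ condEntPart μ π α :=
  csInf_le ⟨0, by rintro _ ⟨β, hβ, _, rfl⟩; exact condEntPart_nonneg hπ hβ⟩ ⟨α, hα, h, rfl⟩

lemma condEntCover_nonneg {μ : Measure X} [IsProbabilityMeasure μ] {π : X → Y} (hπ : Measurable π)
    (V : Finset (Set X)) : 0 ≤ condEntCover μ π V :=
  Real.sInf_nonneg (by rintro _ ⟨β, hβ, _, rfl⟩; exact condEntPart_nonneg hπ hβ)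

lemma exists_lt_condEntCover {μ : Measure X} {π : X → Y}
    {V : Finset (Set X)} (hV : IsCover V) (hVm : ∀ A ∈ V, MeasurableSet A) {ε : ℝ} (hε : 0 < ε) :
    ∃ α, IsMPartition α ∧ Refines α V ∧ condEntPart μ π α < condEntCover μ π V + ε := by
  obtain ⟨α, hα, h⟩ := exists_part hV hVm
  obtain ⟨_, ⟨β, hβ, h2, rfl⟩, h3⟩ := exists_lt_of_csInf_lt
    (s := {h | ∃ α, IsMPartition (X := X) α ∧ Refines α V ∧ h = condEntPart μ π α})
    ⟨_, α, hα, h, rfl⟩ (show condEntCover μ π V < condEntCover μ π V + ε by linarith)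
  exact ⟨β, hβ, h2, h3⟩

lemma condEntCover_part {μ : Measure X} [IsProbabilityMeasure μ] {π : X → Y} (hπ : Measurable π)
    {α : Finset (Set X)} (hα : IsMPartition α) : condEntCover μ π α = condEntPart μ π α := by
  apply le_antisymm (condEntCover_le hπ hα fun A hA => ⟨A, hA, subset_rfl⟩)
  unfold condEntCover
  refine le_csInf ⟨condEntPart μ π α, α, hα, fun A hA => ⟨A, hA, subset_rfl⟩, rfl⟩ ?_
  rintro _ ⟨β, hβ, h, rfl⟩
  exact condEntPart_mono hπ hα hβ h

end
end AscLocal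

namespace AscLocal

section
variable {G X : Type*} [DecidableEq G]

lemma mem_coverDyn {act : G → X → X} {V : Finset (Set X)} {S : Finset G} {C : Set X} :
    C ∈ coverDyn act V S ↔ ∃ f : (∀ g ∈ S, Set X), (∀ g h, f g h ∈ V) ∧
      (⋂ g, ⋂ (h : g ∈ S), act g ⁻¹' f g h) = C := by
  classical
  unfold coverDyn
  simp only [Finset.mem_image, Finset.mem_pi]

lemma refines_coverDyn {act : G → X → X} {V : Finset (Set X)} {S : Finset G}
    {α : Finset (Set X)} :
    Refines α (coverDyn act V S) ↔ ∀ A ∈ α, ∀ g ∈ S, ∃ B ∈ V, A ⊆ act g ⁻¹' B := by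
  constructor
  · intro h A hA g hg
    obtain ⟨C, hC, hAC⟩ := h A hA
    obtain ⟨f, hf, rfl⟩ := mem_coverDyn.1 hC
    exact ⟨f g hg, hf g hg, fun x hx => mem_iInter₂.1 (hAC hx) g hg⟩
  · intro h A hA
    choose f hf hf2 using h A hA
    exact ⟨_, mem_coverDyn.2 ⟨f, hf, rfl⟩, fun x hx => mem_iInter₂.2 fun g hg => hf2 g hg hx⟩

lemma coverDyn_cover [MeasurableSpace X] {act : G → X → X} {V : Finset (Set X)} (hV : IsCover V) (S : Finset G) :
    IsCover (coverDyn act V S) := by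
  rw [isCover_iff] at *
  intro x
  choose f hf hf2 using hV
  exact ⟨_, mem_coverDyn.2 ⟨fun g _ => f (act g x), fun g _ => hf _, rfl⟩,
    mem_iInter₂.2 fun g _ => hf2 _⟩

lemma coverDyn_open [TopologicalSpace X] {act : G → X → X} (hact : ∀ g, Continuous (act g))
    {V : Finset (Set X)} (hV : ∀ A ∈ V, IsOpen A) (S : Finset G) :
    ∀ A ∈ coverDyn act V S, IsOpen A := by
  intro A hA
  obtain ⟨f, hf, rfl⟩ := mem_coverDyn.1 hA
  have : (⋂ g, ⋂ (h : g ∈ S), act g ⁻¹' f g h) = ⋂ g : S, act g.1 ⁻¹' f g.1 g.2 := by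
    ext x; simp
  rw [this]
  exact isOpen_iInter_of_finite fun g => (hV _ (hf _ _)).preimage (hact _)

lemma coverDyn_meas [MeasurableSpace X] {act : G → X → X} (hact : ∀ g, Measurable (act g))
    {V : Finset (Set X)} (hV : ∀ A ∈ V, MeasurableSet A) (S : Finset G) :
    ∀ A ∈ coverDyn act V S, MeasurableSet A := by
  intro A hA
  obtain ⟨f, hf, rfl⟩ := mem_coverDyn.1 hA
  have : (⋂ g, ⋂ (h : g ∈ S), act g ⁻¹' f g h) = ⋂ g : S, act g.1 ⁻¹' f g.1 g.2 := by
    ext x; simp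
  rw [this]
  exact MeasurableSet.iInter fun g => hact _ (hV _ (hf _ _))

lemma coverDyn_part [MeasurableSpace X] {act : G → X → X} (hact : ∀ g, Measurable (act g))
    {V : Finset (Set X)} (hV : IsMPartition V) (S : Finset G) :
    IsMPartition (coverDyn act V S) := by
  refine ⟨coverDyn_cover hV.1 S, coverDyn_meas hact hV.2.1 S, ?_⟩
  intro A hA B hB hne
  obtain ⟨f, hf, rfl⟩ := mem_coverDyn.1 hA
  obtain ⟨f', hf', rfl⟩ := mem_coverDyn.1 hB
  rw [Set.disjoint_left]
  intro x hx hx'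
  apply hne
  have : f = f' := by
    funext g hg
    by_contra h
    exact Set.disjoint_left.1 (hV.2.2 _ (hf g hg) _ (hf' g hg) h)
      (mem_iInter₂.1 hx g hg) (mem_iInter₂.1 hx' g hg)
  rw [this]
end

section
variable {X Y : Type*} [MeasurableSpace X] [MetricSpace Y] [MeasurableSpace Y] [BorelSpace Y]

lemma hset_inv {μ : Measure X} [IsProbabilityMeasure μ] {π : X → Y} (hπ : Measurable π)
    {T : X → X} (hT : Measurable T) (hμ : Measure.map T μ = μ) {R : Y → Y} (hR : Continuous R)
    (hTR : ∀ x, π (T x) = R (π x)) {A : Set X} (hA : MeasurableSet A) :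
    hset μ π (T ⁻¹' A) ≤ hset μ π A := by
  apply le_of_forall_pos_le_add
  intro ε hε
  obtain ⟨δ, s, hδ, hs, h1, h2⟩ := hset_approx (μ := μ) hπ hA hε
  refine le_trans ?_ h2
  refine (hset_le_psi hπ (hT hA) (hs.comp hR).measurable hδ (fun y => h1 (R y))).trans
    (le_of_eq ?_)
  unfold Psi
  conv_rhs => rw [← hμ]
  rw [integral_map hT.aemeasurable]
  · apply integral_congr_ae
    refine Eventually.of_forall fun x => ?_
    simp only [Function.comp, hTR]
    rfl
  · rw [hμ]
    exact (int_psi_aux hπ (measurable_const.indicator hA)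
      (Eventually.of_forall (ind_range A)) hs.measurable hδ h1).2.2.aestronglyMeasurable

variable {G : Type*} [Group G] [DecidableEq G]

/-- the standing dynamical assumptions -/
structure Dyn (μ : Measure X) (π : X → Y) (act : G → X → X) (actY : G → Y → Y) : Prop where
  prob : IsProbabilityMeasure μ
  mπ : Measurable π
  meas : ∀ g, Measurable (act g)
  one : ∀ x, act 1 x = x
  mul : ∀ g h x, act (g * h) x = act g (act h x)
  contY : ∀ g, Continuous (actY g)
  fac : ∀ g x, π (act g x) = actY g (π x)
  inv : ∀ g, Measure.map (act g) μ = μ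

variable {μ : Measure X} {π : X → Y} {act : G → X → X} {actY : G → Y → Y}

open Classical in
lemma Dyn.pre (D : Dyn μ π act actY) {α : Finset (Set X)} (hα : IsMPartition α) (g : G) :
    IsMPartition (α.image fun A => act g ⁻¹' A) ∧
    condEntPart μ π (α.image fun A => act g ⁻¹' A) ≤ condEntPart μ π α := by
  have := D.prob
  constructor
  · refine ⟨?_, ?_, ?_⟩
    · rw [isCover_iff]
      intro x
      obtain ⟨A, hA, hx⟩ := hα.cov (act g x)
      exact ⟨_, Finset.mem_image_of_mem _ hA, hx⟩
    · intro A hA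
      obtain ⟨A, hA', rfl⟩ := Finset.mem_image.1 hA
      exact D.meas g (hα.2.1 A hA')
    · intro A hA B hB hne
      obtain ⟨A, hA', rfl⟩ := Finset.mem_image.1 hA
      obtain ⟨B, hB', rfl⟩ := Finset.mem_image.1 hB
      apply Disjoint.preimage
      apply hα.2.2 A hA' B hB'
      rintro rfl
      exact hne rfl
  · rw [condEntPart_eq, condEntPart_eq]
    calc _ ≤ ∑ A ∈ α, hset μ π (act g ⁻¹' A) :=
          Finset.sum_image_le_of_nonneg fun A hA => by
            obtain ⟨A, hA', rfl⟩ := Finset.mem_image.1 hA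
            exact hset_nonneg D.mπ (D.meas g (hα.2.1 A hA'))
      _ ≤ _ := Finset.sum_le_sum fun A hA =>
          hset_inv D.mπ (D.meas g) (D.inv g) (D.contY g) (D.fac g) (hα.2.1 A hA)

lemma Dyn.ow (D : Dyn μ π act actY) {lam : Measure ℝ} (hlam : IsCoeffMeasure lam)
    {V : Finset (Set X)} (hV : IsCover V) (hVm : ∀ A ∈ V, MeasurableSet A)
    {α₀ : Finset (Set X)} (hα₀ : IsMPartition α₀) (hα₀V : Refines α₀ V) :
    OWFun (avg lam fun S => condEntCover μ π (coverDyn act V S)) (α₀.card : ℝ) := by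
  classical
  have := D.prob
  apply avg_ow hlam (Nat.cast_nonneg _)
  · intro A B
    apply le_of_forall_pos_le_add
    intro ε hε
    obtain ⟨a, ha, haV, hae⟩ := exists_lt_condEntCover (μ := μ) (π := π)
      (coverDyn_cover (act := act) hV A) (coverDyn_meas D.meas hVm A) (half_pos hε)
    obtain ⟨b, hb, hbV, hbe⟩ := exists_lt_condEntCover (μ := μ) (π := π)
      (coverDyn_cover (act := act) hV B) (coverDyn_meas D.meas hVm B) (half_pos hε)
    rw [refines_coverDyn] at haV hbV
    have := condEntCover_le (μ := μ) D.mπ (joinP_part ha hb)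
      (V := coverDyn act V (A ∪ B)) (by
        rw [refines_coverDyn]
        intro C hC g hg
        obtain ⟨P, hP, Q, hQ, rfl⟩ := mem_joinP.1 hC
        rcases Finset.mem_union.1 hg with h | h
        · obtain ⟨E, hE, h⟩ := haV P hP g h
          exact ⟨E, hE, Set.inter_subset_left.trans h⟩
        · obtain ⟨E, hE, h⟩ := hbV Q hQ g h
          exact ⟨E, hE, Set.inter_subset_right.trans h⟩)
    have h2 := condEntPart_join (μ := μ) D.mπ ha hb
    linarith
  · intro A g
    apply le_of_forall_pos_le_add
    intro ε hε
    obtain ⟨a, ha, haV, hae⟩ := exists_lt_condEntCover (μ := μ) (π := π)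
      (coverDyn_cover (act := act) hV A) (coverDyn_meas D.meas hVm A) hε
    rw [refines_coverDyn] at haV
    have ⟨p1, p2⟩ := D.pre ha g
    have := condEntCover_le (μ := μ) D.mπ p1
      (V := coverDyn act V (A.image fun h => h * g)) (by
        rw [refines_coverDyn]
        intro C hC k hk
        obtain ⟨P, hP, rfl⟩ := Finset.mem_image.1 hC
        obtain ⟨k, hk', rfl⟩ := Finset.mem_image.1 hk
        obtain ⟨E, hE, h⟩ := haV P hP k hk'
        refine ⟨E, hE, fun x hx => ?_⟩
        have := h hx
        simpa [D.mul] using this)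
    linarith
  · intro A
    exact condEntCover_nonneg D.mπ _
  · have hu : IsMPartition ({Set.univ} : Finset (Set X)) := by
      refine ⟨by simp [isCover_iff], by simp, ?_⟩
      intro A hA B hB hne
      simp at hA hB
      exact absurd (hA.trans hB.symm) hne
    have := condEntCover_le (μ := μ) D.mπ hu
      (V := coverDyn act V ∅) (by rw [refines_coverDyn]; simp)
    rw [condEntPart_eq] at this
    simpa [hset_univ D.mπ] using this
  · intro g
    have ⟨p1, p2⟩ := D.pre hα₀ g
    refine (condEntCover_le D.mπ p1 ?_).trans (p2.trans (condEntPart_le_card D.mπ hα₀))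
    rw [refines_coverDyn]
    intro C hC k hk
    obtain ⟨P, hP, rfl⟩ := Finset.mem_image.1 hC
    rw [Finset.mem_singleton.1 hk]
    obtain ⟨E, hE, h⟩ := hα₀V P hP
    exact ⟨E, hE, Set.preimage_mono h⟩

lemma Dyn.ow_part (D : Dyn μ π act actY) {lam : Measure ℝ} (hlam : IsCoeffMeasure lam)
    {α : Finset (Set X)} (hα : IsMPartition α) :
    OWFun (avg lam fun S => condEntPart μ π (coverDyn act α S)) (α.card : ℝ) := by
  have := D.prob
  have h := D.ow hlam hα.1 hα.2.1 hα (fun A hA => ⟨A, hA, subset_rfl⟩)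
  simpa only [condEntCover_part D.mπ (coverDyn_part D.meas hα _)] using h

lemma Dyn.minus_lim (D : Dyn μ π act actY) {lam : Measure ℝ} (hlam : IsCoeffMeasure lam)
    {F : ℕ → Finset G} (hF : IsFolner F)
    {V : Finset (Set X)} (hV : IsCover V) (hVm : ∀ A ∈ V, MeasurableSet A) :
    0 ≤ AscCondMinus μ π (coeff lam) act V F ∧
    Tendsto (fun n => avg lam (fun S => condEntCover μ π (coverDyn act V S)) (F n) / (F n).card)
      atTop (nhds (AscCondMinus μ π (coeff lam) act V F)) := by
  obtain ⟨α₀, h0, h1⟩ := exists_part hV hVm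
  obtain ⟨l, hl, ht⟩ := ow_lim hF (Nat.cast_nonneg _) (D.ow hlam hV hVm h0 h1)
  have : AscCondMinus μ π (coeff lam) act V F = l := by
    unfold AscCondMinus limSeq
    apply Tendsto.limUnder_eq
    refine ht.congr fun n => ?_
    rw [avg, div_eq_inv_mul, one_div]
  rw [this]
  exact ⟨hl, ht⟩

lemma Dyn.part_lim (D : Dyn μ π act actY) {lam : Measure ℝ} (hlam : IsCoeffMeasure lam)
    {F : ℕ → Finset G} (hF : IsFolner F)
    {α : Finset (Set X)} (hα : IsMPartition α) :
    0 ≤ AscCondPart μ π (coeff lam) act α F ∧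
    Tendsto (fun n => avg lam (fun S => condEntPart μ π (coverDyn act α S)) (F n) / (F n).card)
      atTop (nhds (AscCondPart μ π (coeff lam) act α F)) := by
  obtain ⟨l, hl, ht⟩ := ow_lim hF (Nat.cast_nonneg _) (D.ow_part hlam hα)
  have : AscCondPart μ π (coeff lam) act α F = l := by
    unfold AscCondPart limSeq
    apply Tendsto.limUnder_eq
    refine ht.congr fun n => ?_
    rw [ascCondPartSeq, avg, div_eq_inv_mul, one_div]
  rw [this]
  exact ⟨hl, ht⟩

end
end AscLocal

namespace AscLocal

lemma prod_diff {ι : Type*} (S : Finset ι) (a b : ι → ℝ) (ha : ∀ i ∈ S, 0 ≤ a i ∧ a i ≤ 1)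
    (hb : ∀ i ∈ S, 0 ≤ b i ∧ b i ≤ 1) :
    |∏ i ∈ S, a i - ∏ i ∈ S, b i| ≤ ∑ i ∈ S, |a i - b i| := by
  classical
  induction S using Finset.induction_on with
  | empty => simp
  | insert i S hi ih =>
    rw [Finset.prod_insert hi, Finset.prod_insert hi, Finset.sum_insert hi]
    have ih := ih (fun j hj => ha j (Finset.mem_insert_of_mem hj))
      (fun j hj => hb j (Finset.mem_insert_of_mem hj))
    have a1 := ha i (Finset.mem_insert_self _ _)
    have b0 : 0 ≤ ∏ j ∈ S, b j :=
      Finset.prod_nonneg fun j hj => (hb j (Finset.mem_insert_of_mem hj)).1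
    have b1 : ∏ j ∈ S, b j ≤ 1 :=
      Finset.prod_le_one (fun j hj => (hb j (Finset.mem_insert_of_mem hj)).1)
        (fun j hj => (hb j (Finset.mem_insert_of_mem hj)).2)
    have e : a i * ∏ j ∈ S, a j - b i * ∏ j ∈ S, b j =
      a i * (∏ j ∈ S, a j - ∏ j ∈ S, b j) + (a i - b i) * ∏ j ∈ S, b j := by ring
    rw [e]
    refine (abs_add_le _ _).trans ?_
    rw [abs_mul, abs_mul, abs_of_nonneg a1.1, abs_of_nonneg b0]
    have := abs_nonneg (a i - b i)
    have := abs_nonneg (∏ j ∈ S, a j - ∏ j ∈ S, b j)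
    nlinarith

section
variable {X : Type*} [MetricSpace X] [CompactSpace X] [MeasurableSpace X] [BorelSpace X]

/-- topological approximation of a Borel partition -/
structure Pack (μ : Measure X) (α U : Finset (Set X)) (η : ℝ) (b : Set X → Set X)
    (g : Set X → X → ℝ) (k m : X → ℝ) : Prop where
  bm : ∀ A ∈ α, MeasurableSet (b A)
  bcov : ∀ x, ∃ A ∈ α, x ∈ b A
  bd : ∀ A ∈ α, ∀ B ∈ α, A ≠ B → Disjoint (b A) (b B)
  bU : ∀ A ∈ α, ∃ V ∈ U, b A ⊆ V
  gc : ∀ A ∈ α, Continuous (g A)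
  g01 : ∀ A ∈ α, ∀ x, 0 ≤ g A x ∧ g A x ≤ 1
  kc : Continuous k
  k0 : ∀ x, 0 ≤ k x
  km : ∀ x, k x ≤ m x
  mm : Measurable m
  m1 : ∀ x, m x ≤ 1
  hm : ∫ x, m x ∂μ ≤ η
  hb : ∀ A ∈ α, ∀ x, |(b A).indicator (fun _ => (1:ℝ)) x - g A x| ≤ k x
  ha : ∀ A ∈ α, ∀ x, |A.indicator (fun _ => (1:ℝ)) x - g A x| ≤ m x

lemma exists_pack {μ : Measure X} [IsProbabilityMeasure μ] {α U : Finset (Set X)}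
    (hα : IsMPartition α) (hU : ∀ V ∈ U, IsOpen V) (h : Refines α U) {η : ℝ} (hη : 0 < η) :
    ∃ b g k m, Pack μ α U η b g k m := by
  classical
  set η' : ℝ := η / (α.card + 1) with hη'
  have hη'0 : 0 < η' := by positivity
  have hK : ∀ A, ∃ K, A ∈ α → IsClosed K ∧ K ⊆ A ∧ μ (A \ K) < ENNReal.ofReal η' := by
    intro A
    by_cases hA : A ∈ α
    · obtain ⟨K, hKA, hK, h⟩ := (hα.2.1 A hA).exists_isClosed_sdiff_lt (measure_ne_top μ A)
        (ε := ENNReal.ofReal η') (by simpa using hη'0)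
      exact ⟨K, fun _ => ⟨hK, hKA, h⟩⟩
    · exact ⟨∅, fun h => absurd h hA⟩
  choose K hK using hK
  have hV : ∀ A, ∃ V, A ∈ α → V ∈ U ∧ A ⊆ V := by
    intro A
    by_cases hA : A ∈ α
    · obtain ⟨V, hV, h⟩ := h A hA
      exact ⟨V, fun _ => ⟨hV, h⟩⟩
    · exact ⟨∅, fun h => absurd h hA⟩
  choose V hV using hV
  have hH : ∀ A, ∃ f : C(X, ℝ), A ∈ α → (∀ x ∈ K A, f x = 1) ∧
      (∀ A' ∈ α, A' ≠ A → ∀ x ∈ K A', f x = 0) ∧ ∀ x, x ∉ V A → f x = 0 := by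
    intro A
    by_cases hA : A ∈ α
    · have hc : IsClosed ((⋃ A' ∈ α.erase A, K A') ∪ (V A)ᶜ) := by
        apply IsClosed.union
        · apply Set.Finite.isClosed_biUnion (α.erase A).finite_toSet
          intro A' hA'
          exact (hK A' (Finset.mem_of_mem_erase hA')).1
        · exact (hU _ (hV A hA).1).isClosed_compl
      have hd : Disjoint ((⋃ A' ∈ α.erase A, K A') ∪ (V A)ᶜ) (K A) := by
        rw [Set.disjoint_left]
        rintro x (hx | hx) hx'
        · obtain ⟨A', hA', hx⟩ := mem_iUnion₂.1 hx
          have h1 := (Finset.mem_erase.1 hA')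
          exact Set.disjoint_left.1 (hα.2.2 A' h1.2 A hA h1.1) ((hK A' h1.2).2.1 hx)
            ((hK A hA).2.1 hx')
        · exact hx ((hV A hA).2 ((hK A hA).2.1 hx'))
      obtain ⟨f, f0, f1, _⟩ := exists_continuous_zero_one_of_isClosed hc (hK A hA).1 hd
      refine ⟨f, fun _ => ⟨fun x hx => f1 hx, fun A' hA' hne x hx => f0 (Or.inl ?_),
        fun x hx => f0 (Or.inr hx)⟩⟩
      exact mem_iUnion₂.2 ⟨A', Finset.mem_erase.2 ⟨hne, hA'⟩, hx⟩
    · exact ⟨0, fun h => absurd h hA⟩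
  choose H hH using hH
  set O : Set X → Set X := fun A => {x | 0 < H A x} ∩ ⋂ A' ∈ α.erase A, {x | H A' x < H A x}
    with hO
  have Oo : ∀ A, IsOpen (O A) := by
    intro A
    apply IsOpen.inter
    · exact isOpen_lt continuous_const (H A).continuous
    · apply isOpen_biInter_finset
      intro A' _
      exact isOpen_lt (H A').continuous (H A).continuous
  have Od : ∀ A ∈ α, ∀ B ∈ α, A ≠ B → ∀ x ∈ O A, x ∉ O B := by
    intro A hA B hB hne x hx hx'
    have h1 : H B x < H A x := mem_iInter₂.1 hx.2 B (Finset.mem_erase.2 ⟨hne.symm, hB⟩)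
    have h2 : H A x < H B x := mem_iInter₂.1 hx'.2 A (Finset.mem_erase.2 ⟨hne, hA⟩)
    exact lt_asymm h1 h2
  have KO : ∀ A ∈ α, K A ⊆ O A := by
    intro A hA x hx
    have h1 := (hH A hA).1 x hx
    refine ⟨by simp [h1], mem_iInter₂.2 fun A' hA' => ?_⟩
    have h3 := Finset.mem_erase.1 hA'
    have h2 := (hH A' h3.2).2.1 A hA h3.1.symm x hx
    simp [h1, h2]
  have OV : ∀ A ∈ α, O A ⊆ V A := by
    intro A hA x hx
    by_contra hxV
    have h1 := (hH A hA).2.2 x hxV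
    have h2 : 0 < H A x := hx.1
    linarith
  have hg : ∀ A, ∃ f : C(X, ℝ), A ∈ α → (∀ x ∉ O A, f x = 0) ∧ (∀ x ∈ K A, f x = 1) ∧
      ∀ x, 0 ≤ f x := by
    intro A
    by_cases hA : A ∈ α
    · obtain ⟨f, f0, f1, f2⟩ := exists_continuous_zero_one_of_isClosed
        (Oo A).isClosed_compl (hK A hA).1
        (Set.disjoint_left.2 fun x hx hx' => hx (KO A hA hx'))
      exact ⟨f, fun _ => ⟨fun x hx => f0 hx, fun x hx => f1 hx, fun x => (f2 x).1⟩⟩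
    · exact ⟨0, fun h => absurd h hA⟩
  choose g hg using hg
  set b : Set X → Set X := fun A => O A ∪ (A \ ⋃ B ∈ α, O B) with hb
  set O' : Set X := ⋃ A ∈ α, {x | 1 / 2 < g A x} with hO'
  set KK : Set X := ⋃ A ∈ α, K A with hKK
  have O'o : IsOpen O' := isOpen_biUnion fun A _ => isOpen_lt continuous_const (g A).continuous
  have KKc : IsClosed KK :=
    Set.Finite.isClosed_biUnion α.finite_toSet fun A hA => (hK A hA).1
  have KO' : KK ⊆ O' := by
    intro x hx
    obtain ⟨A, hA, hx⟩ := mem_iUnion₂.1 hx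
    refine mem_iUnion₂.2 ⟨A, hA, ?_⟩
    have := (hg A hA).2.1 x hx
    show 1 / 2 < g A x
    rw [this]; norm_num
  obtain ⟨k, k0, k1, k2⟩ := exists_continuous_zero_one_of_isClosed KKc O'o.isClosed_compl
    (Set.disjoint_left.2 fun x hx hx' => hx' (KO' hx))
  have eqb : ∀ A ∈ α, ∀ x ∈ O', (b A).indicator (fun _ => (1:ℝ)) x = min 1 (2 * g A x) := by
    intro A hA x hx
    obtain ⟨A0, hA0, hx⟩ := mem_iUnion₂.1 hx
    have hx : 1 / 2 < g A0 x := hx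
    have hxO : x ∈ O A0 := by
      by_contra hn
      have := (hg A0 hA0).1 x hn
      linarith
    by_cases hAA : A = A0
    · subst hAA
      rw [Set.indicator_of_mem (show x ∈ b A from Or.inl hxO), min_eq_left (by linarith)]
    · have hn := Od A0 hA0 A hA (Ne.symm hAA) x hxO
      rw [Set.indicator_of_notMem, (hg A hA).1 x hn]
      · simp
      · rintro (h | h)
        · exact hn h
        · exact h.2 (mem_iUnion₂.2 ⟨A0, hA0, hxO⟩)
  have eqa : ∀ A ∈ α, ∀ x ∈ KK, A.indicator (fun _ => (1:ℝ)) x = min 1 (2 * g A x) := by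
    intro A hA x hx
    obtain ⟨A0, hA0, hx⟩ := mem_iUnion₂.1 hx
    have hxA := (hK A0 hA0).2.1 hx
    by_cases hAA : A = A0
    · subst hAA
      rw [Set.indicator_of_mem hxA, (hg A hA).2.1 x hx]
      norm_num
    · have hn := Od A0 hA0 A hA (Ne.symm hAA) x (KO A0 hA0 hx)
      rw [Set.indicator_of_notMem, (hg A hA).1 x hn]
      · simp
      · intro h
        exact Set.disjoint_left.1 (hα.2.2 A hA A0 hA0 hAA) h hxA
  have g01 : ∀ A ∈ α, ∀ x, 0 ≤ min 1 (2 * g A x) ∧ min 1 (2 * g A x) ≤ 1 := by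
    intro A hA x
    have := (hg A hA).2.2 x
    exact ⟨le_min zero_le_one (by linarith), min_le_left _ _⟩
  have ab1 : ∀ A ∈ α, ∀ (B : Set X) x,
      |B.indicator (fun _ => (1:ℝ)) x - min 1 (2 * g A x)| ≤ 1 := by
    intro A hA B x
    have h1 := g01 A hA x
    have h2 := ind_range B x
    rw [abs_le]; constructor <;> linarith
  refine ⟨b, fun A x => min 1 (2 * g A x), k, KKᶜ.indicator fun _ => (1:ℝ),
    ?_, ?_, ?_, ?_, ?_, g01, k.continuous, fun x => (k2 x).1, ?_, ?_, fun x => (ind_range _ x).2,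
    ?_, ?_, ?_⟩
  · intro A hA
    exact (Oo A).measurableSet.union ((hα.2.1 A hA).diff
      (Finset.measurableSet_biUnion _ fun B _ => (Oo B).measurableSet))
  · intro x
    by_cases hx : x ∈ ⋃ B ∈ α, O B
    · obtain ⟨A, hA, hx⟩ := mem_iUnion₂.1 hx
      exact ⟨A, hA, Or.inl hx⟩
    · obtain ⟨A, hA, hxA⟩ := hα.cov x
      exact ⟨A, hA, Or.inr ⟨hxA, hx⟩⟩
  · intro A hA B hB hne
    rw [Set.disjoint_left]
    rintro x (h1 | h1) (h2 | h2)
    · exact Od A hA B hB hne x h1 h2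
    · exact h2.2 (mem_iUnion₂.2 ⟨A, hA, h1⟩)
    · exact h1.2 (mem_iUnion₂.2 ⟨B, hB, h2⟩)
    · exact Set.disjoint_left.1 (hα.2.2 A hA B hB hne) h1.1 h2.1
  · intro A hA
    exact ⟨V A, (hV A hA).1, Set.union_subset (OV A hA)
      (Set.sdiff_subset.trans (hV A hA).2)⟩
  · intro A hA
    exact continuous_const.min (continuous_const.mul (g A).continuous)
  · intro x
    by_cases hx : x ∈ KK
    · rw [k0 hx]; exact (ind_range _ x).1
    · rw [Set.indicator_of_mem hx]; exact (k2 x).2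
  · exact measurable_const.indicator KKc.measurableSet.compl
  · rw [integral_indicator KKc.measurableSet.compl]
    simp only [integral_const, smul_eq_mul, mul_one, measureReal_restrict_apply_univ]
    have hsub : KKᶜ ⊆ ⋃ A ∈ α, A \ K A := by
      intro x hx
      obtain ⟨A, hA, hxA⟩ := hα.cov x
      exact mem_iUnion₂.2 ⟨A, hA, hxA, fun h => hx (mem_iUnion₂.2 ⟨A, hA, h⟩)⟩
    calc μ.real KKᶜ ≤ μ.real (⋃ A ∈ α, A \ K A) := measureReal_mono hsub (measure_ne_top _ _)
      _ ≤ ∑ A ∈ α, μ.real (A \ K A) := measureReal_biUnion_finset_le _ _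
      _ ≤ ∑ A ∈ α, η' := Finset.sum_le_sum fun A hA =>
          ENNReal.toReal_le_of_le_ofReal hη'0.le (hK A hA).2.2.le
      _ = α.card * η' := by simp
      _ ≤ η := by
          rw [hη', mul_div_assoc', div_le_iff₀ (by positivity)]
          nlinarith
  · intro A hA x
    by_cases hx : x ∈ O'
    · rw [eqb A hA x hx]; simpa using (k2 x).1
    · rw [k1 hx]; exact ab1 A hA _ x
  · intro A hA x
    by_cases hx : x ∈ KK
    · rw [eqa A hA x hx]; simpa using (ind_range _ x).1
    · rw [Set.indicator_of_mem (a := x) (s := KKᶜ) hx]; exact ab1 A hA _ x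

end
end AscLocal

namespace AscLocal

lemma ind_iInter {G X : Type*} {S : Finset G} (act : G → X → X) (σ : ∀ g ∈ S, Set X) (x : X) :
    (⋂ g, ⋂ (h : g ∈ S), act g ⁻¹' σ g h).indicator (fun _ => (1:ℝ)) x =
      ∏ i ∈ S.attach, (σ i.1 i.2).indicator (fun _ => (1:ℝ)) (act i.1 x) := by
  by_cases hx : x ∈ (⋂ g, ⋂ (h : g ∈ S), act g ⁻¹' σ g h)
  · rw [Set.indicator_of_mem hx, Finset.prod_eq_one]
    intro i _
    have h : act i.1 x ∈ σ i.1 i.2 := mem_iInter₂.1 hx i.1 i.2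
    exact Set.indicator_of_mem h _
  · rw [Set.indicator_of_notMem hx]
    simp only [mem_iInter, not_forall] at hx
    obtain ⟨g, hg, hx⟩ := hx
    rw [Finset.prod_eq_zero (Finset.mem_attach S ⟨g, hg⟩)]
    have h : act g x ∉ σ g hg := hx
    exact Set.indicator_of_notMem h _

lemma meas_inter {G X : Type*} [MeasurableSpace X] {act : G → X → X}
    (hm : ∀ g, Measurable (act g)) {S : Finset G} (σ : ∀ g ∈ S, Set X)
    (hσ : ∀ g h, MeasurableSet (σ g h)) :
    MeasurableSet (⋂ g, ⋂ (h : g ∈ S), act g ⁻¹' σ g h) := by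
  rw [show (⋂ g, ⋂ (h : g ∈ S), act g ⁻¹' σ g h) =
    ⋂ i : S, act i.1 ⁻¹' σ i.1 i.2 by ext x; simp]
  exact MeasurableSet.iInter fun i => hm _ (hσ _ _)

set_option linter.unusedSectionVars false

section
variable {X Y G : Type*} [MetricSpace X] [CompactSpace X] [MeasurableSpace X] [BorelSpace X]
  [MetricSpace Y] [MeasurableSpace Y] [BorelSpace Y] [Group G] [DecidableEq G]
  {μ : Measure X} {π : X → Y} {act : G → X → X} {actY : G → Y → Y}
  {α U : Finset (Set X)} {η : ℝ} {b : Set X → Set X}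
  {g : Set X → X → ℝ} {k m : X → ℝ}

lemma cont_int {f : X → ℝ} (hf : Continuous f) (ν : Measure X) [IsProbabilityMeasure ν] :
    Integrable f ν :=
  hf.integrable_of_hasCompactSupport (HasCompactSupport.of_compactSpace f)

open Classical in
lemma Pack.part (P : Pack μ α U η b g k m) :
    IsMPartition (α.image b) ∧ Refines (α.image b) U := by
  refine ⟨⟨?_, ?_, ?_⟩, ?_⟩
  · rw [isCover_iff]
    intro x
    obtain ⟨A, hA, hx⟩ := P.bcov x
    exact ⟨_, Finset.mem_image_of_mem _ hA, hx⟩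
  · intro A hA
    obtain ⟨A, hA', rfl⟩ := Finset.mem_image.1 hA
    exact P.bm A hA'
  · intro A hA B hB hne
    obtain ⟨A, hA', rfl⟩ := Finset.mem_image.1 hA
    obtain ⟨B, hB', rfl⟩ := Finset.mem_image.1 hB
    exact P.bd A hA' B hB' (fun h => hne (by rw [h]))
  · intro A hA
    obtain ⟨A, hA', rfl⟩ := Finset.mem_image.1 hA
    exact P.bU A hA'

lemma Pack.step (P : Pack μ α U η b g k m) (D : Dyn μ π act actY)
    (hα : IsMPartition α)
    (hc : ∀ g, Continuous (act g)) (hπ : Continuous π) {S : Finset G} (σ : ∀ g ∈ S, Set X)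
    (hσ : ∀ g h, σ g h ∈ α) {s : Y → ℝ} {δ : ℝ} (hs : Continuous s) (hδ : 0 < δ)
    (h1 : ∀ y, δ ≤ s y ∧ s y ≤ 1) :
    ∃ Φ : X → ℝ, Continuous Φ ∧
      (∀ ν : Measure X, IsProbabilityMeasure ν →
        hset ν π (⋂ g, ⋂ (h : g ∈ S), act g ⁻¹' b (σ g h)) ≤ ∫ x, Φ x ∂ν) ∧
      ∫ x, Φ x ∂μ ≤ Psi μ π ((⋂ g, ⋂ (h : g ∈ S), act g ⁻¹' σ g h).indicator fun _ => 1) s +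
        2 * (|Real.log δ| + 1) * S.card * η := by
  have := D.prob
  set C : ℝ := |Real.log δ| + 1 with hC
  have hC0 : 0 ≤ C := by positivity
  set w : X → ℝ := fun x => -Real.log (s (π x)) - 1 with hw
  have hwC : ∀ x, |w x| ≤ C := fun x =>
    (log_bd hδ (h1 _).1 (h1 _).2).trans (by
      have := neg_abs_le (Real.log δ); rw [hC]; linarith)
  have hwc : Continuous w :=
    ((hs.comp hπ).log fun x => (hδ.trans_le (h1 _).1).ne').neg.sub continuous_const
  set Γ : X → ℝ := fun x => ∏ i ∈ S.attach, g (σ i.1 i.2) (act i.1 x) with hΓ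
  have hΓc : Continuous Γ :=
    continuous_finsetProd _ fun i _ => (P.gc _ (hσ _ _)).comp (hc _)
  have bb : ∀ x, |(⋂ g, ⋂ (h : g ∈ S), act g ⁻¹' b (σ g h)).indicator (fun _ => (1:ℝ)) x - Γ x|
      ≤ ∑ i ∈ S.attach, k (act i.1 x) := by
    intro x
    rw [ind_iInter act (fun g h => b (σ g h))]
    refine (prod_diff _ _ _ (fun i _ => ind_range _ _) (fun i _ => P.g01 _ (hσ _ _) _)).trans ?_
    exact Finset.sum_le_sum fun i _ => P.hb _ (hσ _ _) _
  have ba : ∀ x, |(⋂ g, ⋂ (h : g ∈ S), act g ⁻¹' σ g h).indicator (fun _ => (1:ℝ)) x - Γ x|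
      ≤ ∑ i ∈ S.attach, m (act i.1 x) := by
    intro x
    rw [ind_iInter act σ]
    refine (prod_diff _ _ _ (fun i _ => ind_range _ _) (fun i _ => P.g01 _ (hσ _ _) _)).trans ?_
    exact Finset.sum_le_sum fun i _ => P.ha _ (hσ _ _) _
  have mul_bd : ∀ (p q r : ℝ) x, |p - q| ≤ r → p * w x ≤ q * w x + C * r := by
    intro p q r x h
    have h2 : (p - q) * w x ≤ r * C := by
      refine (le_abs_self _).trans ?_
      rw [abs_mul]
      exact mul_le_mul h (hwC x) (abs_nonneg _) ((abs_nonneg _).trans h)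
    linarith
  have mB : MeasurableSet (⋂ g, ⋂ (h : g ∈ S), act g ⁻¹' b (σ g h)) := by
    rw [show (⋂ g, ⋂ (h : g ∈ S), act g ⁻¹' b (σ g h)) =
      ⋂ i : S, act i.1 ⁻¹' b (σ i.1 i.2) by ext x; simp]
    exact MeasurableSet.iInter fun i => D.meas _ (P.bm _ (hσ _ _))
  have mA : MeasurableSet (⋂ g, ⋂ (h : g ∈ S), act g ⁻¹' σ g h) := by
    rw [show (⋂ g, ⋂ (h : g ∈ S), act g ⁻¹' σ g h) =
      ⋂ i : S, act i.1 ⁻¹' σ i.1 i.2 by ext x; simp]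
    exact MeasurableSet.iInter fun i => D.meas _ (hα.2.1 _ (hσ _ _))
  have hΦc : Continuous fun x => Γ x * w x + s (π x) + C * ∑ i ∈ S.attach, k (act i.1 x) :=
    ((hΓc.mul hwc).add (hs.comp hπ)).add (continuous_const.mul
      (continuous_finsetSum _ fun i _ => P.kc.comp (hc _)))
  refine ⟨_, hΦc, ?_, ?_⟩
  · intro ν hν
    refine (hset_le_psi D.mπ mB hs.measurable hδ h1).trans ?_
    unfold Psi
    apply integral_mono (int_psi_aux D.mπ (measurable_const.indicator mB)
      (Eventually.of_forall (ind_range _)) hs.measurable hδ h1).2.2 (cont_int hΦc ν)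
    intro x
    have := mul_bd _ _ _ x (bb x)
    simp only [hw] at this ⊢
    linarith
  · have im : Integrable m μ := by
      apply Integrable.of_bound (C := 1) P.mm.aestronglyMeasurable
      refine Eventually.of_forall fun x => ?_
      rw [Real.norm_eq_abs, abs_of_nonneg ((P.k0 x).trans (P.km x))]
      exact P.m1 x
    have im' : ∀ h, Integrable (fun x => m (act h x)) μ := by
      intro h
      have : Integrable m (Measure.map (act h) μ) := by rw [D.inv h]; exact im
      exact this.comp_measurable (D.meas h)
    have em : ∀ h, ∫ x, m (act h x) ∂μ = ∫ x, m x ∂μ := by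
      intro h
      conv_rhs => rw [← D.inv h]
      rw [integral_map (D.meas h).aemeasurable]
      exact P.mm.aestronglyMeasurable
    have ip := int_psi_aux (μ := μ) D.mπ (measurable_const.indicator mA)
      (Eventually.of_forall (ind_range _)) hs.measurable hδ h1
    have is : Integrable (fun x => 2 * C * ∑ i ∈ S.attach, m (act i.1 x)) μ :=
      (integrable_finsetSum _ fun i _ => im' i.1).const_mul _
    calc _ ≤ ∫ x, (((⋂ g, ⋂ (h : g ∈ S), act g ⁻¹' σ g h).indicator (fun _ => (1:ℝ)) x *
          (-Real.log (s (π x)) - 1) + s (π x)) + 2 * C * ∑ i ∈ S.attach, m (act i.1 x)) ∂μ := by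
          apply integral_mono (cont_int hΦc μ) (ip.2.2.add is)
          intro x
          have h2 := mul_bd _ _ _ x ((abs_sub_comm _ _).trans_le (ba x))
          have h3 : ∑ i ∈ S.attach, k (act i.1 x) ≤ ∑ i ∈ S.attach, m (act i.1 x) :=
            Finset.sum_le_sum fun i _ => P.km _
          have h4 := mul_le_mul_of_nonneg_left h3 hC0
          simp only [hw, Pi.add_apply] at h2 ⊢
          linarith
      _ = Psi μ π ((⋂ g, ⋂ (h : g ∈ S), act g ⁻¹' σ g h).indicator fun _ => 1) s +
          2 * C * (S.card * ∫ x, m x ∂μ) := by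
          rw [integral_add ip.2.2 is, integral_const_mul,
            integral_finsetSum _ fun i _ => im' i.1]
          simp only [em, Finset.sum_const, Finset.card_attach, nsmul_eq_mul]
          rfl
      _ ≤ _ := by
          have h5 : 2 * C * (S.card * ∫ x, m x ∂μ) ≤ 2 * C * (S.card * η) := by
            gcongr
            exact P.hm
          linarith

open Classical in
lemma part_le_sum {ν : Measure X} [IsProbabilityMeasure ν] (hπ : Measurable π)
    (hm : ∀ g, Measurable (act g)) (P : Pack μ α U η b g k m) (S : Finset G) :
    condEntPart ν π (coverDyn act (α.image b) S) ≤
      ∑ σ ∈ S.pi (fun _ => α), hset ν π (⋂ g, ⋂ (h : g ∈ S), act g ⁻¹' b (σ g h)) := by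
  rw [condEntPart_eq]
  have nn : ∀ C ∈ (S.pi (fun _ => α)).image
      (fun σ => ⋂ g, ⋂ (h : g ∈ S), act g ⁻¹' b (σ g h)), 0 ≤ hset ν π C := by
    intro C hC
    obtain ⟨σ, hσ, rfl⟩ := Finset.mem_image.1 hC
    rw [Finset.mem_pi] at hσ
    apply hset_nonneg hπ
    rw [show (⋂ g, ⋂ (h : g ∈ S), act g ⁻¹' b (σ g h)) =
      ⋂ i : S, act i.1 ⁻¹' b (σ i.1 i.2) by ext x; simp]
    exact MeasurableSet.iInter fun i => hm _ (P.bm _ (hσ _ _))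
  calc _ ≤ ∑ C ∈ (S.pi (fun _ => α)).image
            (fun σ => ⋂ g, ⋂ (h : g ∈ S), act g ⁻¹' b (σ g h)), hset ν π C := by
        apply Finset.sum_le_sum_of_subset_of_nonneg _ (fun C hC _ => nn C hC)
        intro C hC
        obtain ⟨f, hf, rfl⟩ := mem_coverDyn.1 hC
        have : ∀ g h, ∃ A ∈ α, b A = f g h := fun g h => Finset.mem_image.1 (hf g h)
        choose σ hσ hσ2 using this
        refine Finset.mem_image.2 ⟨σ, Finset.mem_pi.2 hσ, ?_⟩
        simp only [hσ2]
    _ ≤ _ := Finset.sum_image_le_of_nonneg nn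

open Classical in
lemma part_eq_sum (hα : IsMPartition α) (S : Finset G) :
    condEntPart μ π (coverDyn act α S) =
      ∑ σ ∈ S.pi (fun _ => α), hset μ π (⋂ g, ⋂ (h : g ∈ S), act g ⁻¹' σ g h) := by
  rw [condEntPart_eq]
  have : coverDyn act α S = (S.pi (fun _ => α)).image
      (fun σ => ⋂ g, ⋂ (h : g ∈ S), act g ⁻¹' σ g h) := by
    ext C
    rw [mem_coverDyn, Finset.mem_image]
    simp only [Finset.mem_pi]
  rw [this]
  apply Finset.sum_image_of_pairwise_eq_zero
  intro σ hσ σ' hσ' hne he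
  simp only [Finset.mem_coe, Finset.mem_pi] at hσ hσ'
  convert hset_empty μ π
  rw [Set.eq_empty_iff_forall_notMem]
  intro x hx
  have hx' := hx
  rw [he] at hx'
  apply hne
  funext h hh
  by_contra hn
  exact Set.disjoint_left.1 (hα.2.2 _ (hσ h hh) _ (hσ' h hh) hn)
      (mem_iInter₂.1 hx h hh) (mem_iInter₂.1 hx' h hh)

lemma ev_lt {Φ : X → ℝ} (hΦ : Continuous Φ) (ρ : ProbabilityMeasure X) {y : ℝ}
    (h : ∫ x, Φ x ∂ρ.toMeasure < y) :
    ∀ᶠ ν : ProbabilityMeasure X in nhds ρ, ∫ x, Φ x ∂ν.toMeasure < y := by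
  have := (ProbabilityMeasure.tendsto_iff_forall_integral_tendsto
    (μs := fun ν : ProbabilityMeasure X => ν) (F := nhds ρ) (μ := ρ)).1 tendsto_id
    (BoundedContinuousFunction.mkOfCompact ⟨Φ, hΦ⟩)
  exact this.eventually (eventually_lt_nhds h)

lemma lemmaP {ρ : ProbabilityMeasure X} (D : Dyn ρ.toMeasure π act actY)
    (hα : IsMPartition α) (hU : ∀ V ∈ U, IsOpen V) (hαU : Refines α U)
    (hc : ∀ g, Continuous (act g)) (hπ : Continuous π) (E : Finset G) {ε : ℝ} (hε : 0 < ε) :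
    ∃ β, IsMPartition β ∧ Refines β U ∧ β.card ≤ α.card ∧
      ∀ᶠ ν : ProbabilityMeasure X in nhds ρ, ∀ S ⊆ E,
        condEntPart ν.toMeasure π (coverDyn act β S) ≤
          condEntPart ρ.toMeasure π (coverDyn act α S) + ε := by
  classical
  have hmA : ∀ (S : Finset G) (σ : ∀ g ∈ S, Set X), σ ∈ S.pi (fun _ => α) →
      MeasurableSet (⋂ g, ⋂ (h : g ∈ S), act g ⁻¹' σ g h) := by
    intro S σ hσ
    exact meas_inter D.meas σ fun g h => hα.2.1 _ (Finset.mem_pi.1 hσ g h)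
  set N : ℝ := ∑ S ∈ E.powerset, ((S.pi (fun _ => α)).card : ℝ) with hN
  have hN0 : 0 ≤ N := Finset.sum_nonneg fun _ _ => Nat.cast_nonneg _
  have hNle : ∀ S ⊆ E, ((S.pi (fun _ => α)).card : ℝ) ≤ N := fun S hS =>
    Finset.single_le_sum (f := fun S : Finset G => ((S.pi (fun _ => α)).card : ℝ))
      (fun _ _ => Nat.cast_nonneg _) (Finset.mem_powerset.2 hS)
  clear_value N
  set ε' : ℝ := ε / (3 * (N + 1)) with hε'
  have hε'0 : 0 < ε' := by positivity
  have key : ∀ (S : Finset G) (σ : ∀ g ∈ S, Set X), ∃ (δ : ℝ) (s : Y → ℝ),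
      σ ∈ S.pi (fun _ => α) → 0 < δ ∧ Continuous s ∧ (∀ y, δ ≤ s y ∧ s y ≤ 1) ∧
      Psi ρ.toMeasure π ((⋂ g, ⋂ (h : g ∈ S), act g ⁻¹' σ g h).indicator fun _ => 1) s ≤
        hset ρ.toMeasure π (⋂ g, ⋂ (h : g ∈ S), act g ⁻¹' σ g h) + ε' := by
    intro S σ
    by_cases h : σ ∈ S.pi (fun _ => α)
    · obtain ⟨δ, s, hh⟩ := hset_approx (μ := ρ.toMeasure) D.mπ (hmA S σ h) hε'0
      exact ⟨δ, s, fun _ => hh⟩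
    · exact ⟨1, fun _ => 1, fun h' => absurd h' h⟩
  choose δ s key using key
  set C : ℝ := ∑ S ∈ E.powerset, ∑ σ ∈ S.pi (fun _ => α), (|Real.log (δ S σ)| + 1) with hC
  have hC0 : 0 ≤ C :=
    Finset.sum_nonneg fun _ _ => Finset.sum_nonneg fun _ _ => by positivity
  have hCle : ∀ S ⊆ E, ∀ σ ∈ S.pi (fun _ => α), |Real.log (δ S σ)| + 1 ≤ C := by
    intro S hS σ hσ
    refine le_trans ?_ (Finset.single_le_sum
      (f := fun S => ∑ σ ∈ S.pi (fun _ => α), (|Real.log (δ S σ)| + 1))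
      (fun _ _ => Finset.sum_nonneg fun _ _ => by positivity) (Finset.mem_powerset.2 hS))
    exact Finset.single_le_sum (f := fun σ => |Real.log (δ S σ)| + 1)
      (fun _ _ => by positivity) hσ
  clear_value C
  set η : ℝ := ε' / (2 * C * E.card + 1) with hη
  have hη0 : 0 < η := by positivity
  have hηle : 2 * C * E.card * η ≤ ε' := by
    rw [hη, mul_div_assoc', div_le_iff₀ (by positivity)]
    nlinarith
  obtain ⟨b, g, k, m, P⟩ := exists_pack (μ := ρ.toMeasure) hα hU hαU hη0
  refine ⟨α.image b, P.part.1, P.part.2, Finset.card_image_le, ?_⟩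
  have ev : ∀ S ∈ E.powerset, ∀ᶠ ν : ProbabilityMeasure X in nhds ρ,
      ∀ σ ∈ S.pi (fun _ => α),
        hset ν.toMeasure π (⋂ g, ⋂ (h : g ∈ S), act g ⁻¹' b (σ g h)) ≤
        hset ρ.toMeasure π (⋂ g, ⋂ (h : g ∈ S), act g ⁻¹' σ g h) + 3 * ε' := by
    intro S hS
    rw [Finset.mem_powerset] at hS
    rw [Filter.eventually_all_finset]
    intro σ hσ
    obtain ⟨k1, k2, k3, k4⟩ := key S σ hσ
    obtain ⟨Φ, hΦ, p1, p2⟩ := P.step D hα hc hπ σ (Finset.mem_pi.1 hσ) k2 k1 k3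
    have h5 : 2 * (|Real.log (δ S σ)| + 1) * S.card * η ≤ 2 * C * E.card * η := by
      gcongr
      exact hCle S hS σ hσ
    filter_upwards [ev_lt hΦ ρ (y := hset ρ.toMeasure π
      (⋂ g, ⋂ (h : g ∈ S), act g ⁻¹' σ g h) + 3 * ε') (by linarith)] with ν hν
    exact (p1 ν.toMeasure inferInstance).trans hν.le
  rw [← Filter.eventually_all_finset] at ev
  filter_upwards [ev] with ν hν S hS
  have h1 := hν S (Finset.mem_powerset.2 hS)
  refine (part_le_sum D.mπ D.meas P S).trans ?_
  rw [part_eq_sum hα]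
  refine (Finset.sum_le_sum h1).trans ?_
  rw [Finset.sum_add_distrib]
  gcongr
  rw [Finset.sum_const, nsmul_eq_mul]
  have h2 := hNle S hS
  have h3 : 3 * ε' * (N + 1) = ε := by rw [hε']; field_simp
  nlinarith

end
end AscLocal

namespace AscLocal

lemma usc_core {G : Type*} [Group G] [DecidableEq G] {F : ℕ → Finset G} (hF : IsFolner F)
    {l M : ℝ} (hl : 0 ≤ l) (hM : 0 ≤ M) {f0 : Finset G → ℝ}
    (h0 : Tendsto (fun n => f0 (F n) / (F n).card) atTop (nhds l)) {ε : ℝ} (hε : 0 < ε) :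
    ∃ E : Finset (Finset G), ∀ f, OWFun f M → (∀ A ∈ E, f A ≤ f0 A + ε) → ∀ l',
      Tendsto (fun n => f (F n) / (F n).card) atTop (nhds l') → l' ≤ l + 2 * ε + ε * M := by
  obtain ⟨N, hN⟩ := eventually_atTop.1 (h0.eventually (eventually_lt_nhds
    (show l < l + ε by linarith)))
  have hT : IsFolner (F ∘ fun n => n + N) := folner_comp hF (fun a b h => by simpa using h)
  obtain ⟨I, hI⟩ := ow_uniform hF hT ε hε
  refine ⟨I.image fun i => F (i + N), ?_⟩
  intro f hf hle l' hl'
  apply le_of_tendsto hl'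
  filter_upwards [hI] with n hn
  apply hn f M (l + 2 * ε) hf _ (by linarith) hM
  intro i hi
  have h1 := hle _ (Finset.mem_image_of_mem _ hi)
  have h2 := hN (i + N) (by omega)
  have hc : (1:ℝ) ≤ (F (i + N)).card := by
    exact_mod_cast Finset.card_pos.2 (hF.1 _)
  rw [div_lt_iff₀ (by linarith)] at h2
  simp only [Function.comp]
  nlinarith

section
variable {X Y G : Type*} [MetricSpace X] [CompactSpace X] [MeasurableSpace X] [BorelSpace X]
  [MetricSpace Y] [MeasurableSpace Y] [BorelSpace Y] [Group G] [DecidableEq G]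
  {π : X → Y} {act : G → X → X} {actY : G → Y → Y} {U : Finset (Set X)}

lemma cover_usc {ρ : ProbabilityMeasure X} (D : Dyn ρ.toMeasure π act actY)
    (hUc : IsCover U) (hU : ∀ V ∈ U, IsOpen V)
    (hc : ∀ g, Continuous (act g)) (hπ : Continuous π) (S : Finset G) {ε : ℝ} (hε : 0 < ε) :
    ∀ᶠ ν : ProbabilityMeasure X in nhds ρ,
      condEntCover ν.toMeasure π (coverDyn act U S) ≤
        condEntCover ρ.toMeasure π (coverDyn act U S) + ε := by
  have hVo := coverDyn_open hc hU S
  obtain ⟨α, hα, hαV, hlt⟩ := exists_lt_condEntCover (μ := ρ.toMeasure) (π := π)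
    (coverDyn_cover (act := act) hUc S) (fun A hA => (hVo A hA).measurableSet) (half_pos hε)
  obtain ⟨β, hβ, hβV, -, hev⟩ := lemmaP D hα hVo hαV hc hπ {1} (half_pos hε)
  filter_upwards [hev] with ν hν
  have h1 := hν {1} subset_rfl
  have h2 : condEntCover ν.toMeasure π (coverDyn act U S) ≤
      condEntPart ν.toMeasure π (coverDyn act β {1}) := by
    apply condEntCover_le D.mπ (coverDyn_part D.meas hβ _)
    intro C hC
    obtain ⟨f, hf, rfl⟩ := mem_coverDyn.1 hC
    obtain ⟨W, hW, h⟩ := hβV _ (hf 1 (Finset.mem_singleton_self 1))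
    refine ⟨W, hW, fun x hx => h ?_⟩
    have := mem_iInter₂.1 hx 1 (Finset.mem_singleton_self 1)
    simpa only [mem_preimage, D.one] using this
  have h3 : condEntPart ρ.toMeasure π (coverDyn act α {1}) ≤ condEntPart ρ.toMeasure π α := by
    apply condEntPart_mono D.mπ (coverDyn_part D.meas hα _) hα
    rw [refines_coverDyn]
    intro A hA g hg
    refine ⟨A, hA, fun x hx => ?_⟩
    rw [Finset.mem_singleton.1 hg, mem_preimage, D.one]
    exact hx
  linarith

lemma minus_usc {ρ : ProbabilityMeasure X} (D : Dyn ρ.toMeasure π act actY)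
    (hUc : IsCover U) (hU : ∀ V ∈ U, IsOpen V)
    (hc : ∀ g, Continuous (act g)) (hπ : Continuous π)
    {F : ℕ → Finset G} (hF : IsFolner F) {lam : Measure ℝ} (hlam : IsCoeffMeasure lam) {y : ℝ}
    (hy : AscCondMinus ρ.toMeasure π (coeff lam) act U F < y) :
    ∀ᶠ ν : ProbabilityMeasure X in nhds ρ, Dyn ν.toMeasure π act actY →
      AscCondMinus ν.toMeasure π (coeff lam) act U F < y := by
  have hUm : ∀ V ∈ U, MeasurableSet V := fun V hV => (hU V hV).measurableSet
  obtain ⟨α₀, hα₀, hα₀U⟩ := exists_part hUc hUm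
  obtain ⟨hl, ht⟩ := D.minus_lim hlam hF hUc hUm
  set l := AscCondMinus ρ.toMeasure π (coeff lam) act U F with hldef
  have hM : (0:ℝ) ≤ α₀.card := Nat.cast_nonneg _
  set ε : ℝ := (y - l) / (3 + α₀.card) with hε
  have hε0 : 0 < ε := div_pos (by linarith) (by linarith)
  have he : ε * (3 + α₀.card) = y - l := by rw [hε]; field_simp
  obtain ⟨E, hE⟩ := usc_core hF hl hM ht hε0
  have ev : ∀ᶠ ν : ProbabilityMeasure X in nhds ρ, ∀ A ∈ E, ∀ S ∈ A.powerset,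
      condEntCover ν.toMeasure π (coverDyn act U S) ≤
        condEntCover ρ.toMeasure π (coverDyn act U S) + ε := by
    rw [Filter.eventually_all_finset]
    intro A _
    rw [Filter.eventually_all_finset]
    intro S _
    exact cover_usc D hUc hU hc hπ S hε0
  filter_upwards [ev] with ν hν Dν
  have := hE _ (Dν.ow hlam hUc hUm hα₀ hα₀U)
    (fun A hA => avg_le_add hlam _ _ ε A fun S hS => hν A hA S (Finset.mem_powerset.2 hS)) _
    (Dν.minus_lim hlam hF hUc hUm).2
  nlinarith

lemma plus_usc {ρ : ProbabilityMeasure X} (D : Dyn ρ.toMeasure π act actY)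
    (hUc : IsCover U) (hU : ∀ V ∈ U, IsOpen V)
    (hc : ∀ g, Continuous (act g)) (hπ : Continuous π)
    {F : ℕ → Finset G} (hF : IsFolner F) {lam : Measure ℝ} (hlam : IsCoeffMeasure lam) {y : ℝ}
    (hy : AscCondPlus ρ.toMeasure π (coeff lam) act U F < y) :
    ∀ᶠ ν : ProbabilityMeasure X in nhds ρ, Dyn ν.toMeasure π act actY →
      AscCondPlus ν.toMeasure π (coeff lam) act U F < y := by
  have hUm : ∀ V ∈ U, MeasurableSet V := fun V hV => (hU V hV).measurableSet
  obtain ⟨α₀, hα₀, hα₀U⟩ := exists_part hUc hUm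
  have hne : {h | ∃ α, IsMPartition (X := X) α ∧ Refines α U ∧
      h = AscCondPart ρ.toMeasure π (coeff lam) act α F}.Nonempty := ⟨_, α₀, hα₀, hα₀U, rfl⟩
  obtain ⟨_, ⟨α, hα, hαU, rfl⟩, hαy⟩ := exists_lt_of_csInf_lt hne hy
  obtain ⟨hl, ht⟩ := D.part_lim hlam hF hα
  set l := AscCondPart ρ.toMeasure π (coeff lam) act α F with hldef
  have hM : (0:ℝ) ≤ α.card := Nat.cast_nonneg _
  set ε : ℝ := (y - l) / (3 + α.card) with hε
  have hε0 : 0 < ε := div_pos (by linarith) (by linarith)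
  have he : ε * (3 + α.card) = y - l := by rw [hε]; field_simp
  obtain ⟨E, hE⟩ := usc_core hF hl hM ht hε0
  obtain ⟨β, hβ, hβU, hβc, ev⟩ := lemmaP D hα hU hαU hc hπ (E.biUnion id) hε0
  filter_upwards [ev] with ν hν Dν
  have how := Dν.ow_part hlam hβ
  have how' : OWFun (avg lam fun S => condEntPart ν.toMeasure π (coverDyn act β S))
      (α.card : ℝ) := ⟨how.sub, how.inv, how.nn, how.emp, fun A => (how.bd A).trans (by
        gcongr)⟩
  have h1 := hE _ how'
    (fun A hA => avg_le_add hlam _ _ ε A fun S hS =>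
      hν S (hS.trans (Finset.subset_biUnion_of_mem id hA))) _
    (Dν.part_lim hlam hF hβ).2
  have h2 : AscCondPlus ν.toMeasure π (coeff lam) act U F ≤
      AscCondPart ν.toMeasure π (coeff lam) act β F := by
    apply csInf_le
    · refine ⟨0, ?_⟩
      rintro _ ⟨γ, hγ, -, rfl⟩
      exact (Dν.part_lim hlam hF hγ).1
    · exact ⟨β, hβ, hβU, rfl⟩
  nlinarith

end
end AscLocal

open AscLocal

theorem statement8 {G X Y : Type*} [Group G] [DecidableEq G] [Countable G] [Infinite G]
    [MetricSpace X] [CompactSpace X] [MeasurableSpace X] [BorelSpace X]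
    [MetricSpace Y] [CompactSpace Y] [MeasurableSpace Y] [BorelSpace Y]
    (act : G → X → X) (hactc : ∀ g : G, Continuous (act g))
    (hact1 : ∀ x : X, act 1 x = x)
    (hactm : ∀ g h : G, ∀ x : X, act (g * h) x = act g (act h x))
    (actY : G → Y → Y) (hactYc : ∀ g : G, Continuous (actY g))
    (hactY1 : ∀ y : Y, actY 1 y = y)
    (hactYm : ∀ g h : G, ∀ y : Y, actY (g * h) y = actY g (actY h y))
    (π : X → Y) (hπc : Continuous π) (hπs : Function.Surjective π)
    (hfac : ∀ (g : G) (x : X), π (act g x) = actY g (π x))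
    (F : ℕ → Finset G) (hF : IsFolner F)
    (lam : Measure ℝ) (hlam : IsCoeffMeasure lam)
    (U : Finset (Set X)) (hUc : IsCover U) (hUo : ∀ A ∈ U, IsOpen A) :
    UpperSemicontinuousOn
      (fun ρ : ProbabilityMeasure X => AscCondPlus ρ.toMeasure π (coeff lam) act U F)
      {ρ : ProbabilityMeasure X | ∀ g : G, Measure.map (act g) ρ.toMeasure = ρ.toMeasure} ∧
    UpperSemicontinuousOn
      (fun ρ : ProbabilityMeasure X => AscCondMinus ρ.toMeasure π (coeff lam) act U F)
      {ρ : ProbabilityMeasure X | ∀ g : G, Measure.map (act g) ρ.toMeasure = ρ.toMeasure} := by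
  have D : ∀ ρ : ProbabilityMeasure X, (∀ g : G, Measure.map (act g) ρ.toMeasure = ρ.toMeasure) →
      Dyn ρ.toMeasure π act actY := fun ρ h =>
    ⟨inferInstance, hπc.measurable, fun g => (hactc g).measurable, hact1, hactm, hactYc, hfac, h⟩
  constructor
  · intro ρ hρ y hy
    filter_upwards [mem_nhdsWithin_of_mem_nhds
      (plus_usc (D ρ hρ) hUc hUo hactc hπc hF hlam hy), self_mem_nhdsWithin] with ν h1 h2
    exact h1 (D ν h2)
  · intro ρ hρ y hy
    filter_upwards [mem_nhdsWithin_of_mem_nhds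
      (minus_usc (D ρ hρ) hUc hUo hactc hπc hF hlam hy), self_mem_nhdsWithin] with ν h1 h2
    exact h1 (D ν h2)
end
end

section
/- Let G be a countable discrete infinite amenable group acting on a G-system (X,G), μ a G-invariant Borel probability measure on X, and α, β finite Borel partitions of X. For each nonempty finite S ⊆ G fix an enumeration S = {g_1,…,g_{|S|}}. Then Asc_μ(G, α ∨ β) = Asc_μ(G, β) + lim_{n→∞} (1/|F_n|) Σ_{S⊆F_n} c^{F_n}_S Σ_{j=2}^{|S|} H_μ( g_j^{-1}α | g_1^{-1}α ∨ ⋯ ∨ g_{j−1}^{-1}α ∨ β_S ), and in particular the limit on the right-hand side exists. -/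
open MeasureTheory Filter Set

noncomputable section

open AscLocal

lemma aux_sm2 {ι κ : Type*} (s : Finset ι) (t : Finset κ) (p : ι → κ → ℝ)
    (hp : ∀ i ∈ s, ∀ j ∈ t, 0 ≤ p i j) :
    ∑ i ∈ s, ∑ j ∈ t, Real.negMulLog (p i j) + Real.negMulLog (∑ i ∈ s, ∑ j ∈ t, p i j) ≤
      ∑ i ∈ s, Real.negMulLog (∑ j ∈ t, p i j) + ∑ j ∈ t, Real.negMulLog (∑ i ∈ s, p i j) := by
  set r : ι → ℝ := fun i => ∑ j ∈ t, p i j with hr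
  set c : κ → ℝ := fun j => ∑ i ∈ s, p i j with hc
  set m : ℝ := ∑ i ∈ s, r i with hm
  have hmc : m = ∑ j ∈ t, c j := Finset.sum_comm
  have hr0 : ∀ i ∈ s, 0 ≤ r i := fun i hi => Finset.sum_nonneg (hp i hi)
  have hc0 : ∀ j ∈ t, 0 ≤ c j := fun j hj => Finset.sum_nonneg fun i hi => hp i hi j hj
  have hm0 : 0 ≤ m := Finset.sum_nonneg hr0
  have key : ∀ i ∈ s, ∀ j ∈ t, Real.negMulLog (p i j) ≤
      p i j * (-Real.log (r i)) + p i j * (-Real.log (c j)) + p i j * Real.log m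
        + (r i * c j / m - p i j) := by
    intro i hi j hj
    rcases (hp i hi j hj).eq_or_lt with h | h
    · rw [← h]
      simp only [Real.negMulLog_zero, zero_mul, zero_add, sub_zero]
      exact div_nonneg (mul_nonneg (hr0 i hi) (hc0 j hj)) hm0
    · have h1 : 0 < r i := h.trans_le (Finset.single_le_sum (hp i hi) hj)
      have h2 : 0 < c j :=
        h.trans_le (Finset.single_le_sum (f := fun i => p i j) (fun i hi => hp i hi j hj) hi)
      have h3 : 0 < m := h1.trans_le (Finset.single_le_sum hr0 hi)
      have h4 := Real.log_le_sub_one_of_pos (x := r i * c j / (p i j * m)) (by positivity)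
      rw [Real.log_div (by positivity) (by positivity), Real.log_mul h1.ne' h2.ne',
        Real.log_mul h.ne' h3.ne'] at h4
      have h5 := mul_le_mul_of_nonneg_left h4 h.le
      have h6 : p i j * (r i * c j / (p i j * m) - 1) = r i * c j / m - p i j := by
        field_simp
      rw [h6] at h5
      simp only [Real.negMulLog]
      nlinarith
  have hsum := Finset.sum_le_sum fun i hi => Finset.sum_le_sum (key i hi)
  have e1 : ∑ i ∈ s, ∑ j ∈ t, p i j * (-Real.log (r i)) = ∑ i ∈ s, Real.negMulLog (r i) := by
    refine Finset.sum_congr rfl fun i _ => ?_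
    rw [← Finset.sum_mul]; simp [Real.negMulLog, hr]
  have e2 : ∑ i ∈ s, ∑ j ∈ t, p i j * (-Real.log (c j)) = ∑ j ∈ t, Real.negMulLog (c j) := by
    rw [Finset.sum_comm]
    refine Finset.sum_congr rfl fun i _ => ?_
    rw [← Finset.sum_mul]; simp [Real.negMulLog, hc]
  have e3 : ∑ i ∈ s, ∑ j ∈ t, p i j * Real.log m = - Real.negMulLog m := by
    simp_rw [← Finset.sum_mul]
    simp [Real.negMulLog, hm, hr]
  have e4 : ∑ i ∈ s, ∑ j ∈ t, (r i * c j / m - p i j) = 0 := by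
    simp_rw [Finset.sum_sub_distrib, ← Finset.sum_div, ← Finset.mul_sum, ← Finset.sum_mul,
      ← hmc]
    change m * m / m - m = 0
    rcases hm0.eq_or_lt with h | h
    · simp [← h]
    · field_simp; ring
  simp only [Finset.sum_add_distrib] at hsum
  rw [e1, e2, e3, e4] at hsum
  linarith

lemma aux_mono1 {ι : Type*} (s : Finset ι) (p : ι → ℝ) (hp : ∀ i ∈ s, 0 ≤ p i) :
    Real.negMulLog (∑ i ∈ s, p i) ≤ ∑ i ∈ s, Real.negMulLog (p i) := by
  have : Real.negMulLog (∑ i ∈ s, p i) = ∑ i ∈ s, p i * (-Real.log (∑ i ∈ s, p i)) := by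
    rw [← Finset.sum_mul]; simp [Real.negMulLog]
  rw [this]
  refine Finset.sum_le_sum fun i hi => ?_
  rcases (hp i hi).eq_or_lt with h | h
  · simp [← h]
  · have := Real.log_le_log h (Finset.single_le_sum hp hi)
    simp only [Real.negMulLog]
    nlinarith

set_option linter.unusedSectionVars false

section Part
variable {G X : Type*} [MeasurableSpace X]

lemma aux_mem_joinP (P Q : Finset (Set X)) (A : Set X) :
    A ∈ joinP P Q ↔ ∃ B ∈ P, ∃ C ∈ Q, A = B ∩ C := by
  classical
  simp only [joinP, Finset.mem_image, Finset.mem_product, Prod.exists]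
  constructor
  · rintro ⟨B, C, ⟨h1, h2⟩, rfl⟩; exact ⟨B, h1, C, h2, rfl⟩
  · rintro ⟨B, h1, C, h2, rfl⟩; exact ⟨B, C, ⟨h1, h2⟩, rfl⟩

lemma aux_joinP_assoc (P Q R : Finset (Set X)) :
    joinP (joinP P Q) R = joinP P (joinP Q R) := by
  ext A
  simp only [aux_mem_joinP]
  constructor
  · rintro ⟨_, ⟨B, hB, C, hC, rfl⟩, D, hD, rfl⟩
    exact ⟨B, hB, _, ⟨C, hC, D, hD, rfl⟩, Set.inter_assoc _ _ _⟩
  · rintro ⟨B, hB, _, ⟨C, hC, D, hD, rfl⟩, rfl⟩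
    exact ⟨_, ⟨B, hB, C, hC, rfl⟩, D, hD, (Set.inter_assoc _ _ _).symm⟩

lemma aux_part_join {P Q : Finset (Set X)} (hP : IsMPartition P) (hQ : IsMPartition Q) :
    IsMPartition (joinP P Q) := by
  obtain ⟨cP, mP, dP⟩ := hP
  obtain ⟨cQ, mQ, dQ⟩ := hQ
  refine ⟨?_, ?_, ?_⟩
  · refine Set.eq_univ_of_forall fun x => ?_
    have h1 : x ∈ ⋃₀ (P : Set (Set X)) := by rw [cP]; trivial
    have h2 : x ∈ ⋃₀ (Q : Set (Set X)) := by rw [cQ]; trivial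
    obtain ⟨A, hA, hxA⟩ := h1
    obtain ⟨B, hB, hxB⟩ := h2
    exact ⟨A ∩ B, (aux_mem_joinP _ _ _).2 ⟨A, hA, B, hB, rfl⟩, hxA, hxB⟩
  · intro A hA
    obtain ⟨B, hB, C, hC, rfl⟩ := (aux_mem_joinP _ _ _).1 hA
    exact (mP B hB).inter (mQ C hC)
  · intro A hA A' hA' hne
    obtain ⟨B, hB, C, hC, rfl⟩ := (aux_mem_joinP _ _ _).1 hA
    obtain ⟨B', hB', C', hC', rfl⟩ := (aux_mem_joinP _ _ _).1 hA'
    by_cases h : B = B'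
    · have : C ≠ C' := by rintro rfl; exact hne (by rw [h])
      exact (dQ C hC C' hC' this).mono Set.inter_subset_right Set.inter_subset_right
    · exact (dP B hB B' hB' h).mono Set.inter_subset_left Set.inter_subset_left

lemma aux_ent_join (μ : Measure X) {P Q : Finset (Set X)} (hP : IsMPartition P)
    (hQ : IsMPartition Q) :
    entPart μ (joinP P Q) = ∑ A ∈ P, ∑ B ∈ Q, Real.negMulLog (μ.real (A ∩ B)) := by
  classical
  have e : joinP P Q = (P ×ˢ Q).image fun p => p.1 ∩ p.2 := by
    unfold joinP; congr
  unfold entPart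
  rw [e, Finset.sum_image_of_pairwise_eq_zero, Finset.sum_product]
  · rfl
  · rintro ⟨A, B⟩ h ⟨A', B'⟩ h' hne heq
    simp only [Finset.coe_product, Set.mem_prod, Finset.mem_coe] at h h'
    simp only at heq
    have hd : Disjoint (A ∩ B) (A' ∩ B') := by
      by_cases hh : A = A'
      · have : B ≠ B' := by rintro rfl; exact hne (by rw [hh])
        exact (hQ.2.2 B h.2 B' h'.2 this).mono Set.inter_subset_right Set.inter_subset_right
      · exact (hP.2.2 A h.1 A' h'.1 hh).mono Set.inter_subset_left Set.inter_subset_left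
    rw [← heq, disjoint_self] at hd
    simp only
    rw [hd]; simp

lemma aux_marg (μ : Measure X) [IsProbabilityMeasure μ] {P : Finset (Set X)}
    (hP : IsMPartition P) {B : Set X} (hB : MeasurableSet B) :
    μ.real B = ∑ A ∈ P, μ.real (A ∩ B) := by
  rw [← measureReal_biUnion_finset]
  · congr 1
    rw [← Set.iUnion₂_inter]
    have := hP.1
    unfold IsCover at this
    rw [Set.sUnion_eq_biUnion] at this
    simp only [Finset.mem_coe] at this
    rw [this, Set.univ_inter]
  · intro A hA A' hA' hne
    exact (hP.2.2 A hA A' hA' hne).mono Set.inter_subset_left Set.inter_subset_left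
  · intro A hA; exact (hP.2.1 A hA).inter hB

lemma aux_SM (μ : Measure X) [IsProbabilityMeasure μ] {P Q R : Finset (Set X)}
    (hP : IsMPartition P) (hQ : IsMPartition Q) (hR : IsMPartition R) :
    entPart μ (joinP P (joinP Q R)) + entPart μ R ≤
      entPart μ (joinP P R) + entPart μ (joinP Q R) := by
  have h1 : entPart μ (joinP P (joinP Q R)) =
      ∑ C ∈ R, ∑ A ∈ P, ∑ B ∈ Q, Real.negMulLog (μ.real (A ∩ B ∩ C)) := by
    rw [← aux_joinP_assoc, aux_ent_join μ (aux_part_join hP hQ) hR, Finset.sum_comm]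
    refine Finset.sum_congr rfl fun C hC => ?_
    classical
    have e : joinP P Q = (P ×ˢ Q).image fun p => p.1 ∩ p.2 := by
      unfold joinP; congr
    rw [e, Finset.sum_image_of_pairwise_eq_zero, Finset.sum_product]
    rintro ⟨A, B⟩ h ⟨A', B'⟩ h' hne heq
    simp only [Finset.coe_product, Set.mem_prod, Finset.mem_coe] at h h'
    simp only at heq
    have hd : Disjoint (A ∩ B) (A' ∩ B') := by
      by_cases hh : A = A'
      · have : B ≠ B' := by rintro rfl; exact hne (by rw [hh])
        exact (hQ.2.2 B h.2 B' h'.2 this).mono Set.inter_subset_right Set.inter_subset_right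
      · exact (hP.2.2 A h.1 A' h'.1 hh).mono Set.inter_subset_left Set.inter_subset_left
    rw [← heq, disjoint_self] at hd
    simp only
    rw [hd]; simp
  rw [h1, aux_ent_join μ hP hR, aux_ent_join μ hQ hR, Finset.sum_comm (s := P) (t := R),
    Finset.sum_comm (s := Q) (t := R)]
  unfold entPart
  rw [← Finset.sum_add_distrib, ← Finset.sum_add_distrib]
  refine Finset.sum_le_sum fun C hC => ?_
  have key := aux_sm2 P Q (fun A B => μ.real (A ∩ B ∩ C)) (fun _ _ _ _ => measureReal_nonneg)
  have e1 : ∀ B ∈ Q, ∑ A ∈ P, μ.real (A ∩ B ∩ C) = μ.real (B ∩ C) := by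
    intro B hB
    rw [aux_marg μ hP ((hQ.2.1 B hB).inter (hR.2.1 C hC))]
    simp only [Set.inter_assoc]
  have e2 : ∀ A ∈ P, ∑ B ∈ Q, μ.real (A ∩ B ∩ C) = μ.real (A ∩ C) := by
    intro A hA
    rw [aux_marg μ hQ ((hP.2.1 A hA).inter (hR.2.1 C hC))]
    refine Finset.sum_congr rfl fun B _ => ?_
    congr 1
    rw [Set.inter_comm A B, Set.inter_assoc]
  have e3 : ∑ A ∈ P, ∑ B ∈ Q, μ.real (A ∩ B ∩ C) = (μ C).toReal := by
    rw [Finset.sum_congr rfl e2, ← aux_marg μ hP (hR.2.1 C hC)]; rfl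
  have f1 : ∑ B ∈ Q, Real.negMulLog (∑ A ∈ P, μ.real (A ∩ B ∩ C)) =
      ∑ B ∈ Q, Real.negMulLog (μ.real (B ∩ C)) :=
    Finset.sum_congr rfl fun B hB => by rw [e1 B hB]
  have f2 : ∑ A ∈ P, Real.negMulLog (∑ B ∈ Q, μ.real (A ∩ B ∩ C)) =
      ∑ A ∈ P, Real.negMulLog (μ.real (A ∩ C)) :=
    Finset.sum_congr rfl fun A hA => by rw [e2 A hA]
  rw [e3, f1, f2] at key
  exact key

lemma aux_M (μ : Measure X) [IsProbabilityMeasure μ] {P Q : Finset (Set X)}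
    (hP : IsMPartition P) (hQ : IsMPartition Q) :
    entPart μ Q ≤ entPart μ (joinP P Q) := by
  rw [aux_ent_join μ hP hQ, Finset.sum_comm]
  unfold entPart
  refine Finset.sum_le_sum fun C hC => ?_
  have := aux_mono1 P (fun A => μ.real (A ∩ C)) (fun _ _ => measureReal_nonneg)
  rw [← aux_marg μ hP (hQ.2.1 C hC)] at this
  exact this

lemma aux_ent_nonneg (μ : Measure X) [IsProbabilityMeasure μ] (P : Finset (Set X)) :
    0 ≤ entPart μ P :=
  Finset.sum_nonneg fun _ _ => Real.negMulLog_nonneg measureReal_nonneg measureReal_le_one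

lemma aux_part_univ : IsMPartition ({Set.univ} : Finset (Set X)) := by
  refine ⟨by simp [IsCover], by simp, ?_⟩
  intro A hA B hB hne
  simp only [Finset.mem_singleton] at hA hB
  exact absurd (hA.trans hB.symm) hne

lemma aux_join_univ (P : Finset (Set X)) : joinP P {Set.univ} = P := by
  ext A; simp [aux_mem_joinP]

lemma aux_ent_univ (μ : Measure X) [IsProbabilityMeasure μ] :
    entPart μ ({Set.univ} : Finset (Set X)) = 0 := by
  simp [entPart]

lemma aux_sub (μ : Measure X) [IsProbabilityMeasure μ] {P Q : Finset (Set X)}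
    (hP : IsMPartition P) (hQ : IsMPartition Q) :
    entPart μ (joinP P Q) ≤ entPart μ P + entPart μ Q := by
  have := aux_SM μ hP hQ aux_part_univ
  simpa [aux_join_univ, aux_ent_univ] using this

variable [DecidableEq G]

lemma aux_mem_cov (act : G → X → X) (U : Finset (Set X)) (S : Finset G) (A : Set X) :
    A ∈ coverDyn act U S ↔ ∃ f : G → Set X, (∀ g ∈ S, f g ∈ U) ∧
      A = ⋂ g ∈ S, act g ⁻¹' f g := by
  classical
  simp only [coverDyn, Finset.mem_image, Finset.mem_pi]
  constructor
  · rintro ⟨f, hf, rfl⟩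
    refine ⟨fun g => if h : g ∈ S then f g h else ∅, ?_, ?_⟩
    · intro g hg; simp [hg, hf g hg]
    · refine Set.iInter_congr fun g => Set.iInter_congr fun h => ?_
      simp [h]
  · rintro ⟨f, hf, rfl⟩
    exact ⟨fun g _ => f g, hf, rfl⟩

lemma aux_part_cov (act : G → X → X) (hm : ∀ g, Measurable (act g)) {U : Finset (Set X)}
    (hU : IsMPartition U) (S : Finset G) : IsMPartition (coverDyn act U S) := by
  obtain ⟨cU, mU, dU⟩ := hU
  refine ⟨?_, ?_, ?_⟩
  · refine Set.eq_univ_of_forall fun x => ?_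
    have h1 : ∀ y : X, ∃ A ∈ U, y ∈ A := by
      intro y
      have : y ∈ ⋃₀ (U : Set (Set X)) := by rw [cU]; trivial
      exact this
    choose c hc hxc using h1
    exact ⟨_, (aux_mem_cov _ _ _ _).2 ⟨fun g => c (act g x), fun g _ => hc _, rfl⟩,
      by simp [hxc]⟩
  · intro A hA
    obtain ⟨f, hf, rfl⟩ := (aux_mem_cov _ _ _ _).1 hA
    exact Finset.measurableSet_biInter _ fun g hg => hm g (mU _ (hf g hg))
  · intro A hA A' hA' hne
    obtain ⟨f, hf, rfl⟩ := (aux_mem_cov _ _ _ _).1 hA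
    obtain ⟨f', hf', rfl⟩ := (aux_mem_cov _ _ _ _).1 hA'
    have : ∃ g ∈ S, f g ≠ f' g := by
      by_contra! hcon
      exact hne (Set.iInter₂_congr fun g hg => by rw [hcon g hg])
    obtain ⟨g, hg, hne'⟩ := this
    exact ((dU _ (hf g hg) _ (hf' g hg) hne').preimage (act g)).mono
      (Set.biInter_subset_of_mem hg) (Set.biInter_subset_of_mem hg)

lemma aux_biInter_union (S T : Finset G) (f : G → Set X) :
    ⋂ g ∈ S ∪ T, f g = (⋂ g ∈ S, f g) ∩ ⋂ g ∈ T, f g := by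
  ext x
  simp [or_imp, forall_and]

lemma aux_cov_union (act : G → X → X) (U : Finset (Set X)) {S T : Finset G}
    (h : Disjoint S T) :
    coverDyn act U (S ∪ T) = joinP (coverDyn act U S) (coverDyn act U T) := by
  ext A
  simp only [aux_mem_joinP, aux_mem_cov]
  constructor
  · rintro ⟨f, hf, rfl⟩
    refine ⟨_, ⟨f, fun g hg => hf g (Finset.mem_union_left _ hg), rfl⟩, _,
      ⟨f, fun g hg => hf g (Finset.mem_union_right _ hg), rfl⟩, ?_⟩
    rw [aux_biInter_union]
  · rintro ⟨_, ⟨f, hf, rfl⟩, _, ⟨f', hf', rfl⟩, rfl⟩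
    have hT : ∀ g ∈ T, g ∉ S := fun g hg hg' => Finset.disjoint_left.1 h hg' hg
    refine ⟨fun g => if g ∈ S then f g else f' g, ?_, ?_⟩
    · intro g hg
      rcases Finset.mem_union.1 hg with hg | hg
      · simp [hg, hf g hg]
      · simp [hT g hg, hf' g hg]
    · rw [aux_biInter_union]
      congr 1
      · exact Set.iInter₂_congr fun g hg => by simp [hg]
      · exact Set.iInter₂_congr fun g hg => by simp [hT g hg]

lemma aux_cov_insert (act : G → X → X) (U : Finset (Set X)) {S : Finset G} {a : G}
    (h : a ∉ S) :
    coverDyn act U (insert a S) = joinP (coverDyn act U {a}) (coverDyn act U S) := by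
  rw [← aux_cov_union act U (Finset.disjoint_singleton_left.2 h), Finset.insert_eq]

lemma aux_cov_empty (act : G → X → X) (U : Finset (Set X)) :
    coverDyn act U ∅ = {Set.univ} := by
  ext A; simp [aux_mem_cov]

lemma aux_cov_join (act : G → X → X) (U V : Finset (Set X)) (S : Finset G) :
    coverDyn act (joinP U V) S = joinP (coverDyn act U S) (coverDyn act V S) := by
  ext A
  simp only [aux_mem_joinP, aux_mem_cov]
  constructor
  · rintro ⟨f, hf, rfl⟩
    have : ∀ g, ∃ B C, g ∈ S → B ∈ U ∧ C ∈ V ∧ f g = B ∩ C := by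
      intro g
      by_cases hg : g ∈ S
      · obtain ⟨B, hB, C, hC, e⟩ := hf g hg
        exact ⟨B, C, fun _ => ⟨hB, hC, e⟩⟩
      · exact ⟨∅, ∅, fun h => absurd h hg⟩
    choose B C hBC using this
    refine ⟨_, ⟨B, fun g hg => (hBC g hg).1, rfl⟩, _, ⟨C, fun g hg => (hBC g hg).2.1, rfl⟩, ?_⟩
    ext x
    simp only [Set.mem_iInter, Set.mem_inter_iff, ← forall_and]
    refine forall₂_congr fun g hg => ?_
    rw [(hBC g hg).2.2]; rfl
  · rintro ⟨_, ⟨f, hf, rfl⟩, _, ⟨f', hf', rfl⟩, rfl⟩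
    refine ⟨fun g => f g ∩ f' g, fun g hg => ⟨_, hf g hg, _, hf' g hg, rfl⟩, ?_⟩
    ext x
    simp only [Set.mem_iInter, Set.mem_inter_iff, ← forall_and, Set.mem_preimage]

lemma aux_cov_inv [Group G] (act : G → X → X) (hm : ∀ g, Measurable (act g))
    (hact1 : ∀ x : X, act 1 x = x)
    (hactm : ∀ g h : G, ∀ x : X, act (g * h) x = act g (act h x))
    (μ : Measure X) (hinv : ∀ g : G, Measure.map (act g) μ = μ)
    {U : Finset (Set X)} (hU : IsMPartition U) (S : Finset G) (c : G) :
    entPart μ (coverDyn act U (S.image (· * c))) = entPart μ (coverDyn act U S) := by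
  classical
  have e : coverDyn act U (S.image (· * c)) = (coverDyn act U S).image (act c ⁻¹' ·) := by
    ext A
    simp only [aux_mem_cov, Finset.mem_image]
    constructor
    · rintro ⟨f, hf, rfl⟩
      refine ⟨_, ⟨fun g => f (g * c), fun g hg => hf _ ⟨g, hg, rfl⟩, rfl⟩, ?_⟩
      ext x; simp [hactm]
    · rintro ⟨_, ⟨f, hf, rfl⟩, rfl⟩
      refine ⟨fun g => f (g * c⁻¹), ?_, ?_⟩
      · rintro _ ⟨g, hg, rfl⟩; simpa using hf g hg
      · ext x; simp [hactm]
  have hsurj : Function.Surjective (act c) := fun x => ⟨act c⁻¹ x, by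
    rw [← hactm, mul_inv_cancel, hact1]⟩
  unfold entPart
  rw [e, Finset.sum_image fun A _ B _ h => hsurj.preimage_injective h]
  refine Finset.sum_congr rfl fun A hA => ?_
  rw [← Measure.map_apply (hm c) ((aux_part_cov act hm hU S).2.1 A hA), hinv]

end Part

section Coeff
variable {G : Type*}

lemma aux_ae {lam : Measure ℝ} (h : IsCoeffMeasure lam) : ∀ᵐ x ∂lam, x ∈ Set.Icc (0 : ℝ) 1 :=
  h.2.1

lemma aux_int {lam : Measure ℝ} (h : IsCoeffMeasure lam) (m k : ℕ) :
    Integrable (fun x : ℝ => x ^ m * (1 - x) ^ k) lam := by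
  have := h.1
  refine Integrable.of_bound (Continuous.aestronglyMeasurable (by fun_prop)) 1 ?_
  filter_upwards [aux_ae h] with x hx
  have h1 : 0 ≤ 1 - x := by linarith [hx.2]
  rw [Real.norm_of_nonneg (mul_nonneg (pow_nonneg hx.1 _) (pow_nonneg h1 _))]
  exact mul_le_one₀ (pow_le_one₀ hx.1 hx.2) (pow_nonneg h1 _)
    (pow_le_one₀ h1 (by linarith [hx.1]))

lemma aux_coeff_nonneg {lam : Measure ℝ} (h : IsCoeffMeasure lam) (A S : Finset G) :
    0 ≤ coeff lam A S := by
  refine integral_nonneg_of_ae ?_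
  filter_upwards [aux_ae h] with x hx
  have h1 : 0 ≤ 1 - x := by linarith [hx.2]
  exact mul_nonneg (pow_nonneg hx.1 _) (pow_nonneg h1 _)

variable [DecidableEq G]

lemma aux_coeff_rec {lam : Measure ℝ} (h : IsCoeffMeasure lam) {A S : Finset G} {a : G}
    (ha : a ∉ A) (hS : S ⊆ A) :
    coeff lam (insert a A) S + coeff lam (insert a A) (insert a S) = coeff lam A S := by
  have haS : a ∉ S := fun h => ha (hS h)
  have hc := Finset.card_le_card hS
  unfold coeff
  rw [← integral_add (aux_int h _ _) (aux_int h _ _)]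
  congr 1
  ext x
  rw [Finset.card_insert_of_notMem ha, Finset.card_insert_of_notMem haS,
    Nat.add_sub_add_right, Nat.sub_add_comm hc]
  ring

lemma aux_coeff_marg {lam : Measure ℝ} (h : IsCoeffMeasure lam) (A : Finset G)
    (ψ : Finset G → ℝ) (B : Finset G) (hAB : Disjoint A B) :
    ∑ S ∈ (A ∪ B).powerset, coeff lam (A ∪ B) S * ψ (S ∩ A) =
      ∑ T ∈ A.powerset, coeff lam A T * ψ T := by
  induction B using Finset.induction_on with
  | empty =>
    rw [Finset.union_empty]
    refine Finset.sum_congr rfl fun S hS => ?_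
    rw [Finset.inter_eq_left.2 (Finset.mem_powerset.1 hS)]
  | insert b B hb ih =>
    rw [Finset.disjoint_insert_right] at hAB
    rw [← ih hAB.2, Finset.union_insert]
    have hb' : b ∉ A ∪ B := by simp [hAB.1, hb]
    rw [Finset.sum_powerset_insert hb', ← Finset.sum_add_distrib]
    refine Finset.sum_congr rfl fun S hS => ?_
    rw [Finset.insert_inter_of_notMem hAB.1, ← add_mul,
      aux_coeff_rec h hb' (Finset.mem_powerset.1 hS)]

lemma aux_coeff_marg' {lam : Measure ℝ} (h : IsCoeffMeasure lam) {A F : Finset G}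
    (hA : A ⊆ F) (ψ : Finset G → ℝ) :
    ∑ S ∈ F.powerset, coeff lam F S * ψ (S ∩ A) = ∑ T ∈ A.powerset, coeff lam A T * ψ T := by
  have := aux_coeff_marg h A ψ (F \ A) Finset.disjoint_sdiff
  rwa [Finset.union_sdiff_of_subset hA] at this

lemma aux_coeff_sum {lam : Measure ℝ} (h : IsCoeffMeasure lam) (F : Finset G) :
    ∑ S ∈ F.powerset, coeff lam F S = 1 := by
  have := aux_coeff_marg' h (Finset.empty_subset F) (fun _ => 1)
  have h1 := h.1
  simpa [coeff] using this

lemma aux_shearer (φ : Finset G → ℝ) (h0 : φ ∅ = 0)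
    (hsm : ∀ T S : Finset G, ∀ a, T ⊆ S → a ∉ S → φ (insert a S) + φ T ≤ φ (insert a T) + φ S)
    {ι : Type*} (I : Finset ι) (A : ι → Finset G) (k : ℕ) (S : Finset G)
    (hk : ∀ g ∈ S, (I.filter fun i => g ∈ A i).card = k) :
    k * φ S ≤ ∑ i ∈ I, φ (S ∩ A i) := by
  classical
  induction S using Finset.induction_on with
  | empty => simp [h0]
  | insert a S ha ih =>
    have ih' := ih fun g hg => hk g (Finset.mem_insert_of_mem hg)
    have hka := hk a (Finset.mem_insert_self _ _)
    have key : ∀ i ∈ I, φ (S ∩ A i) + (if a ∈ A i then φ (insert a S) - φ S else 0) ≤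
        φ (insert a S ∩ A i) := by
      intro i _
      by_cases hi : a ∈ A i
      · rw [if_pos hi, Finset.insert_inter_of_mem hi]
        have := hsm (S ∩ A i) S a Finset.inter_subset_left ha
        linarith
      · rw [if_neg hi, Finset.insert_inter_of_notMem hi, add_zero]
    have hs := Finset.sum_le_sum key
    rw [Finset.sum_add_distrib, ← Finset.sum_filter, Finset.sum_const, hka, nsmul_eq_mul] at hs
    linarith

/-- The average of `φ` over random subsets. -/
def auxAvg (lam : Measure ℝ) (φ : Finset G → ℝ) (F : Finset G) : ℝ :=
  ∑ S ∈ F.powerset, coeff lam F S * φ S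

lemma aux_avg_nonneg {lam : Measure ℝ} (h : IsCoeffMeasure lam) {φ : Finset G → ℝ}
    (hφ : ∀ S, 0 ≤ φ S) (F : Finset G) : 0 ≤ auxAvg lam φ F :=
  Finset.sum_nonneg fun S _ => mul_nonneg (aux_coeff_nonneg h _ _) (hφ S)

lemma aux_avg_le {lam : Measure ℝ} (h : IsCoeffMeasure lam) {φ : Finset G → ℝ} {C : ℝ}
    (F : Finset G) (hφ : ∀ S ⊆ F, φ S ≤ C) : auxAvg lam φ F ≤ C := by
  calc auxAvg lam φ F ≤ ∑ S ∈ F.powerset, coeff lam F S * C :=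
        Finset.sum_le_sum fun S hS =>
          mul_le_mul_of_nonneg_left (hφ S (Finset.mem_powerset.1 hS)) (aux_coeff_nonneg h _ _)
    _ = C := by rw [← Finset.sum_mul, aux_coeff_sum h, one_mul]

variable [Group G]

lemma aux_avg_inv (lam : Measure ℝ) {φ : Finset G → ℝ}
    (hinv : ∀ S : Finset G, ∀ c, φ (S.image (· * c)) = φ S) (K : Finset G) (c : G) :
    auxAvg lam φ (K.image (· * c)) = auxAvg lam φ K := by
  have hi : Function.Injective (· * c : G → G) := mul_left_injective c
  unfold auxAvg
  rw [Finset.powerset_image, Finset.sum_image fun A _ B _ h => Finset.image_injective hi h]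
  refine Finset.sum_congr rfl fun S _ => ?_
  rw [hinv]
  simp only [coeff, Finset.card_image_of_injective _ hi]

/-- symmetric difference as in `IsFolner`. -/
def auxSD (F : Finset G) (g : G) : Finset G :=
  (((F.image fun h => g * h) \ F) ∪ (F \ (F.image fun h => g * h)))

lemma aux_main_ineq {lam : Measure ℝ} (h : IsCoeffMeasure lam) (φ : Finset G → ℝ) (h0 : φ ∅ = 0)
    (hnn : ∀ S, 0 ≤ φ S)
    (hsm : ∀ T S : Finset G, ∀ a, T ⊆ S → a ∉ S → φ (insert a S) + φ T ≤ φ (insert a T) + φ S)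
    (hinv : ∀ S : Finset G, ∀ c, φ (S.image (· * c)) = φ S)
    (K F : Finset G) (hK : K.Nonempty) :
    K.card * auxAvg lam φ F ≤ F.card * auxAvg lam φ K +
      K.card * φ {1} * ∑ p ∈ K ×ˢ K, ((auxSD F (p.1 * p.2⁻¹)).card : ℝ) := by
  have hC0 := hnn {1}
  have hsing : ∀ g : G, φ {g} = φ {1} := fun g => by simpa using hinv {1} g
  have hcard : ∀ S : Finset G, φ S ≤ S.card * φ {1} := by
    intro S
    induction S using Finset.induction_on with
    | empty => simp [h0]
    | insert a S ha ih =>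
      have := hsm ∅ S a (Finset.empty_subset _) ha
      rw [Finset.card_insert_of_notMem ha]
      have h2 := hsing a
      simp only [insert_empty_eq] at this
      push_cast
      linarith
  set I : Finset G := (K ×ˢ F).image (fun p => p.1⁻¹ * p.2) with hI
  set A : G → Finset G := fun c => K.image (· * c) with hA
  have hAc : ∀ c, (A c).card = K.card := fun c =>
    Finset.card_image_of_injective _ (mul_left_injective c)
  have hcount : ∀ g ∈ F, (I.filter fun c => g ∈ A c).card = K.card := by
    intro g hg
    have : (I.filter fun c => g ∈ A c) = K.image (fun k => k⁻¹ * g) := by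
      ext c
      simp only [hI, hA, Finset.mem_filter, Finset.mem_image, Finset.mem_product, Prod.exists]
      constructor
      · rintro ⟨_, k, hk, rfl⟩; exact ⟨k, hk, by group⟩
      · rintro ⟨k, hk, rfl⟩; exact ⟨⟨k, g, ⟨hk, hg⟩, rfl⟩, k, hk, by group⟩
    rw [this, Finset.card_image_of_injective]
    intro x y hxy
    simpa using hxy
  have s1 : K.card * auxAvg lam φ F ≤ ∑ c ∈ I, auxAvg lam φ (A c ∩ F) := by
    have e : ∀ c, auxAvg lam φ (A c ∩ F) =
        ∑ S ∈ F.powerset, coeff lam F S * φ (S ∩ A c) := by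
      intro c
      unfold auxAvg
      rw [← aux_coeff_marg' h Finset.inter_subset_right φ]
      refine Finset.sum_congr rfl fun S hS => ?_
      rw [Finset.inter_comm (A c) F, ← Finset.inter_assoc,
        Finset.inter_eq_left.2 (Finset.mem_powerset.1 hS)]
    simp_rw [e]
    rw [Finset.sum_comm]
    unfold auxAvg
    rw [Finset.mul_sum]
    refine Finset.sum_le_sum fun S hS => ?_
    rw [← Finset.mul_sum, mul_left_comm]
    exact mul_le_mul_of_nonneg_left (aux_shearer φ h0 hsm I A K.card S
      fun g hg => hcount g (Finset.mem_powerset.1 hS hg)) (aux_coeff_nonneg h _ _)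
  have s2 : ∑ c ∈ I, auxAvg lam φ (A c ∩ F) ≤
      ∑ c ∈ I, if A c ⊆ F then auxAvg lam φ K else K.card * φ {1} := by
    refine Finset.sum_le_sum fun c _ => ?_
    split_ifs with hc
    · rw [Finset.inter_eq_left.2 hc, hA, aux_avg_inv lam hinv]
    · refine aux_avg_le h _ fun S hS => (hcard S).trans ?_
      refine mul_le_mul_of_nonneg_right ?_ hC0
      rw [← hAc c]
      exact_mod_cast Finset.card_le_card (hS.trans Finset.inter_subset_left)
  rw [Finset.sum_ite, Finset.sum_const, Finset.sum_const, nsmul_eq_mul, nsmul_eq_mul] at s2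
  have hgood : (I.filter fun c => A c ⊆ F).card ≤ F.card := by
    obtain ⟨k, hk⟩ := hK
    refine Finset.card_le_card_of_injOn (fun c => k * c) ?_ (mul_right_injective k).injOn
    intro c hc
    simp only [Finset.coe_filter, Set.mem_ofPred_eq] at hc
    exact hc.2 (Finset.mem_image_of_mem (· * c) hk)
  have hbad : (I.filter fun c => ¬ A c ⊆ F).card ≤
      ∑ p ∈ K ×ˢ K, (auxSD F (p.1 * p.2⁻¹)).card := by
    have hsub : (I.filter fun c => ¬ A c ⊆ F) ⊆
        (K ×ˢ K).biUnion fun p => (auxSD F (p.1 * p.2⁻¹)).image (fun f => p.1⁻¹ * f) := by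
      intro c hc
      simp only [hI, hA, Finset.mem_filter, Finset.mem_image, Finset.mem_product, Prod.exists,
        Finset.not_subset] at hc
      obtain ⟨⟨k, f, ⟨hk, hf⟩, rfl⟩, _, ⟨k', hk', rfl⟩, hn⟩ := hc
      simp only [Finset.mem_biUnion, Finset.mem_product, Finset.mem_image, Prod.exists]
      refine ⟨k, k', ⟨hk, hk'⟩, f, ?_, rfl⟩
      refine Finset.mem_union_right _ (Finset.mem_sdiff.2 ⟨hf, ?_⟩)
      intro hmem
      obtain ⟨y, hy, hyf⟩ := Finset.mem_image.1 hmem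
      apply hn
      have : k' * (k⁻¹ * f) = y := by rw [← hyf]; group
      rwa [this]
    refine (Finset.card_le_card hsub).trans (Finset.card_biUnion_le.trans ?_)
    exact Finset.sum_le_sum fun p _ => Finset.card_image_le
  have hbad' : (((I.filter fun c => ¬ A c ⊆ F).card : ℕ) : ℝ) ≤
      ∑ p ∈ K ×ˢ K, ((auxSD F (p.1 * p.2⁻¹)).card : ℝ) := by exact_mod_cast hbad
  have hgood' : (((I.filter fun c => A c ⊆ F).card : ℕ) : ℝ) ≤ F.card := by exact_mod_cast hgood
  have t1 := mul_le_mul_of_nonneg_right hgood' (aux_avg_nonneg h hnn K)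
  have t2 := mul_le_mul_of_nonneg_right hbad' (mul_nonneg (Nat.cast_nonneg K.card) hC0)
  linarith

lemma aux_limit {lam : Measure ℝ} (h : IsCoeffMeasure lam) (φ : Finset G → ℝ) (h0 : φ ∅ = 0)
    (hnn : ∀ S, 0 ≤ φ S)
    (hsm : ∀ T S : Finset G, ∀ a, T ⊆ S → a ∉ S → φ (insert a S) + φ T ≤ φ (insert a T) + φ S)
    (hinv : ∀ S : Finset G, ∀ c, φ (S.image (· * c)) = φ S)
    (F : ℕ → Finset G) (hF : IsFolner F) :
    ∃ L, Tendsto (fun n => (1 / ((F n).card : ℝ)) * auxAvg lam φ (F n)) atTop (nhds L) := by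
  set V : Set ℝ := {v | ∃ K : Finset G, K.Nonempty ∧ v = (1 / (K.card : ℝ)) * auxAvg lam φ K}
    with hV
  have hbdd : BddBelow V := by
    refine ⟨0, ?_⟩
    rintro _ ⟨K, _, rfl⟩
    exact mul_nonneg (by positivity) (aux_avg_nonneg h hnn K)
  have hne : V.Nonempty := ⟨_, {1}, by simp, rfl⟩
  refine ⟨sInf V, tendsto_order.2 ⟨fun b hb => ?_, fun b hb => ?_⟩⟩
  · exact Eventually.of_forall fun n => hb.trans_le (csInf_le hbdd ⟨F n, hF.1 n, rfl⟩)
  · obtain ⟨_, ⟨K, hK, rfl⟩, hlt⟩ := exists_lt_of_csInf_lt hne hb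
    have hδ : Tendsto (fun n => (1 / (K.card : ℝ)) * auxAvg lam φ K + φ {1} *
        ∑ p ∈ K ×ˢ K, ((auxSD (F n) (p.1 * p.2⁻¹)).card : ℝ) / ((F n).card : ℝ)) atTop
        (nhds ((1 / (K.card : ℝ)) * auxAvg lam φ K + φ {1} * ∑ p ∈ K ×ˢ K, (0 : ℝ))) :=
      tendsto_const_nhds.add (tendsto_const_nhds.mul
        (tendsto_finsetSum _ fun p _ => hF.2 (p.1 * p.2⁻¹)))
    simp only [Finset.sum_const_zero, mul_zero, add_zero] at hδ
    filter_upwards [(tendsto_order.1 hδ).2 b hlt] with n hn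
    refine lt_of_le_of_lt ?_ hn
    have hineq := aux_main_ineq h φ h0 hnn hsm hinv K (F n) hK
    have hk : (0 : ℝ) < K.card := by exact_mod_cast hK.card_pos
    have hf : (0 : ℝ) < (F n).card := by exact_mod_cast (hF.1 n).card_pos
    rw [← Finset.sum_div]
    have e : (1 / (K.card : ℝ)) * auxAvg lam φ K + φ {1} *
        ((∑ p ∈ K ×ˢ K, ((auxSD (F n) (p.1 * p.2⁻¹)).card : ℝ)) / ((F n).card : ℝ)) =
        ((F n).card * auxAvg lam φ K +
      K.card * φ {1} * ∑ p ∈ K ×ˢ K, ((auxSD (F n) (p.1 * p.2⁻¹)).card : ℝ)) /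
        (K.card * (F n).card) := by
      field_simp
    rw [e, le_div_iff₀ (by positivity)]
    refine le_trans (le_of_eq ?_) hineq
    field_simp

lemma aux_card_tendsto [Infinite G] (F : ℕ → Finset G) (hF : IsFolner F) :
    Tendsto (fun n => ((F n).card : ℝ)) atTop atTop := by
  refine tendsto_natCast_atTop_atTop.comp (tendsto_atTop.2 fun M => ?_)
  obtain ⟨K, hK⟩ := Infinite.exists_subset_card_eq G (M + 1)
  have hev : ∀ᶠ n in atTop, ∀ g ∈ K,
      ((auxSD (F n) g).card : ℝ) / ((F n).card : ℝ) < 1 / (M + 1 : ℝ) := by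
    rw [Filter.eventually_all_finset]
    intro g _
    exact (tendsto_order.1 (hF.2 g)).2 _ (by positivity)
  filter_upwards [hev] with n hn
  by_contra! hlt
  have hf : (0 : ℝ) < (F n).card := by exact_mod_cast (hF.1 n).card_pos
  have hM : ((F n).card : ℝ) < M := by exact_mod_cast hlt
  have hsub : ∀ g ∈ K, auxSD (F n) g = ∅ := by
    intro g hg
    have h1 := hn g hg
    rw [div_lt_div_iff₀ hf (by positivity)] at h1
    by_contra hne
    have h2 : 1 ≤ (auxSD (F n) g).card :=
      Finset.card_pos.2 (Finset.nonempty_iff_ne_empty.2 hne)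
    have h3 : (1 : ℝ) ≤ (auxSD (F n) g).card := by exact_mod_cast h2
    nlinarith
  obtain ⟨x, hx⟩ := hF.1 n
  have : K.card ≤ (F n).card := by
    refine Finset.card_le_card_of_injOn (fun g => g * x) ?_ (mul_left_injective x).injOn
    intro g hg
    by_contra hcon
    have : g * x ∈ auxSD (F n) g :=
      Finset.mem_union_left _ (Finset.mem_sdiff.2 ⟨Finset.mem_image_of_mem _ hx, hcon⟩)
    rw [hsub g hg] at this
    simp at this
  omega

end Coeff

lemma aux_ent_limit {G X : Type*} [Group G] [DecidableEq G] [MeasurableSpace X]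
    (act : G → X → X) (hm : ∀ g, Measurable (act g))
    (hact1 : ∀ x : X, act 1 x = x)
    (hactm : ∀ g h : G, ∀ x : X, act (g * h) x = act g (act h x))
    (F : ℕ → Finset G) (hF : IsFolner F)
    (lam : Measure ℝ) (hlam : IsCoeffMeasure lam)
    (μ : Measure X) [IsProbabilityMeasure μ]
    (hinv : ∀ g : G, Measure.map (act g) μ = μ)
    (α : Finset (Set X)) (hα : IsMPartition α) :
    ∃ L, Tendsto (fun n => (1 / ((F n).card : ℝ)) *
      ∑ S ∈ (F n).powerset, coeff lam (F n) S * entPart μ (coverDyn act α S)) atTop (nhds L) := by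
  refine aux_limit hlam (fun S => entPart μ (coverDyn act α S)) ?_ ?_ ?_ ?_ F hF
  · simp only [aux_cov_empty, aux_ent_univ]
  · exact fun S => aux_ent_nonneg μ _
  · intro T S a hTS ha
    have haT : a ∉ T := fun h => ha (hTS h)
    have hS : coverDyn act α S = joinP (coverDyn act α (S \ T)) (coverDyn act α T) := by
      rw [← aux_cov_union act α Finset.sdiff_disjoint, Finset.sdiff_union_of_subset hTS]
    rw [aux_cov_insert act α ha, aux_cov_insert act α haT, hS]
    exact aux_SM μ (aux_part_cov act hm hα _) (aux_part_cov act hm hα _)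
      (aux_part_cov act hm hα _)
  · exact fun S c => aux_cov_inv act hm hact1 hactm μ hinv hα S c


theorem statement11 {G X : Type*} [Group G] [DecidableEq G] [Countable G] [Infinite G]
    [MetricSpace X] [CompactSpace X] [MeasurableSpace X] [BorelSpace X]
    (act : G → X → X) (hactc : ∀ g : G, Continuous (act g))
    (hact1 : ∀ x : X, act 1 x = x)
    (hactm : ∀ g h : G, ∀ x : X, act (g * h) x = act g (act h x))
    (F : ℕ → Finset G) (hF : IsFolner F)
    (lam : Measure ℝ) (hlam : IsCoeffMeasure lam)
    (μ : Measure X) (hμ : IsProbabilityMeasure μ)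
    (hinv : ∀ g : G, Measure.map (act g) μ = μ)
    (α β : Finset (Set X)) (hα : IsMPartition α) (hβ : IsMPartition β)
    (enum : Finset G → ℕ → G)
    (henum : ∀ S : Finset G, (Finset.range S.card).image (enum S) = S) :
    ∃ L : ℝ,
      Tendsto (fun n => (1 / ((F n).card : ℝ)) *
          ∑ S ∈ (F n).powerset, coeff lam (F n) S *
            ∑ j ∈ Finset.Ico 1 S.card,
              (entPart μ (joinP (coverDyn act α {enum S j})
                  (joinP (coverDyn act α ((Finset.range j).image (enum S)))
                    (coverDyn act β S))) -
                entPart μ (joinP (coverDyn act α ((Finset.range j).image (enum S)))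
                  (coverDyn act β S))))
        atTop (nhds L) ∧
      AscPart μ (coeff lam) act (joinP α β) F = AscPart μ (coeff lam) act β F + L := by
  have hm : ∀ g, Measurable (act g) := fun g => (hactc g).measurable
  have hαβ := aux_part_join hα hβ
  obtain ⟨L1, hL1⟩ := aux_ent_limit act hm hact1 hactm F hF lam hlam μ hinv _ hαβ
  obtain ⟨L2, hL2⟩ := aux_ent_limit act hm hact1 hactm F hF lam hlam μ hinv β hβ
  set D : Finset G → ℕ → ℝ := fun S j =>
    entPart μ (joinP (coverDyn act α ((Finset.range j).image (enum S))) (coverDyn act β S))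
    with hD
  set E : Finset G → ℝ := fun S =>
    if S = ∅ then 0 else D S 1 - entPart μ (coverDyn act β S) with hE
  set C : ℝ := entPart μ (coverDyn act α {1}) with hC
  have hC0 : 0 ≤ C := aux_ent_nonneg μ _
  have hsing : ∀ g : G, entPart μ (coverDyn act α {g}) = C := fun g => by
    simpa using aux_cov_inv act hm hact1 hactm μ hinv hα {1} g
  have hE0 : ∀ S, 0 ≤ E S ∧ E S ≤ C := by
    intro S
    simp only [hE, hD]
    split_ifs with h
    · exact ⟨le_rfl, hC0⟩
    · have h1 := aux_M μ (aux_part_cov act hm hα {enum S 0}) (aux_part_cov act hm hβ S)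
      have h2 := aux_sub μ (aux_part_cov act hm hα {enum S 0}) (aux_part_cov act hm hβ S)
      rw [hsing] at h2
      simp only [Finset.range_one, Finset.image_singleton]
      constructor <;> linarith
  have htel : ∀ S : Finset G, ∑ j ∈ Finset.Ico 1 S.card,
      (entPart μ (joinP (coverDyn act α {enum S j})
          (joinP (coverDyn act α ((Finset.range j).image (enum S)))
            (coverDyn act β S))) -
        entPart μ (joinP (coverDyn act α ((Finset.range j).image (enum S)))
          (coverDyn act β S))) =
      entPart μ (coverDyn act (joinP α β) S) - entPart μ (coverDyn act β S) - E S := by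
    intro S
    by_cases hS : S = ∅
    · subst hS
      simp [hE, aux_cov_empty, aux_ent_univ]
    have hpos : 1 ≤ S.card := Finset.card_pos.2 (Finset.nonempty_iff_ne_empty.2 hS)
    have hinj : Set.InjOn (enum S) (Finset.range S.card) := by
      rw [← Finset.card_image_iff, henum S, Finset.card_range]
    have hterm : ∀ j ∈ Finset.Ico 1 S.card,
        (entPart μ (joinP (coverDyn act α {enum S j})
          (joinP (coverDyn act α ((Finset.range j).image (enum S)))
            (coverDyn act β S))) -
        entPart μ (joinP (coverDyn act α ((Finset.range j).image (enum S)))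
          (coverDyn act β S))) = D S (j + 1) - D S j := by
      intro j hj
      have hj' := (Finset.mem_Ico.1 hj).2
      have hn : enum S j ∉ (Finset.range j).image (enum S) := by
        intro hmem
        obtain ⟨i, hi, hij⟩ := Finset.mem_image.1 hmem
        have hi' := Finset.mem_range.1 hi
        have := hinj (by simp; omega) (by simpa using hj') hij
        omega
      simp only [hD]
      rw [Finset.range_add_one, Finset.image_insert, aux_cov_insert act α hn, aux_joinP_assoc]
    rw [Finset.sum_congr rfl hterm, Finset.sum_Ico_sub _ hpos]
    have : D S S.card = entPart μ (coverDyn act (joinP α β) S) := by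
      simp only [hD]; rw [henum S, aux_cov_join]
    rw [this]
    simp only [hE, if_neg hS]
    ring
  have herr : Tendsto (fun n => (1 / ((F n).card : ℝ)) * auxAvg lam E (F n)) atTop (nhds 0) := by
    have hup : Tendsto (fun n => (1 / ((F n).card : ℝ)) * C) atTop (nhds 0) := by
      have := (tendsto_inv_atTop_zero.comp (aux_card_tendsto F hF)).mul_const C
      simpa [Function.comp_def] using this
    refine squeeze_zero (fun n => ?_) (fun n => ?_) hup
    · exact mul_nonneg (by positivity) (aux_avg_nonneg hlam (fun S => (hE0 S).1) _)
    · exact mul_le_mul_of_nonneg_left (aux_avg_le hlam _ fun S _ => (hE0 S).2) (by positivity)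
  refine ⟨L1 - L2, ?_, ?_⟩
  · have := (hL1.sub hL2).sub herr
    rw [sub_zero] at this
    refine this.congr fun n => ?_
    unfold auxAvg
    rw [← mul_sub, ← mul_sub, ← Finset.sum_sub_distrib, ← Finset.sum_sub_distrib]
    congr 1
    refine Finset.sum_congr rfl fun S _ => ?_
    rw [htel S]; ring
  · unfold AscPart limSeq
    rw [hL1.limUnder_eq, hL2.limUnder_eq]; ring
end
end
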